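/- Let G and H be finite groups. Suppose the character table of G and the character table of H differ by only one row or by only one column; that is, either (a) there is a bijection Φ between the irreducible characters of G and of H, distinguished conjugacy classes c₀ of G and d₀ of H, and a bijection σ from the conjugacy classes of G other than c₀ to the conjugacy classes of H other than d₀ such that χ(c) = Φ(χ)(σ(c)) for every irreducible character χ of G and every conjugacy class c ≠ c₀ of G; or (b) there are distinguished irreducible characters χ₀ of G and ψ₀ of H, a bijection Φ from the irreducible characters of G other than χ₀ to the irreducible characters of H other than ψ₀, and a bijection σ between the conjugacy classes of G and of H such that χ(c) = Φ(χ)(σ(c)) for every irreducible character χ ≠ χ₀ of G and every conjugacy class c of G. Then the character tables of G and H are identical: there exist a bijection Φ' between all irreducible characters of G and of H and a bijection σ' between all conjugacy classes of G and of H such that χ(c) = Φ'(χ)(σ'(c)) for every irreducible character χ of G and every conjugacy class c of G. -/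

import Mathlib

open CategoryTheory

/-- `χ : G → ℂ` is the character of an irreducible (simple) finite-dimensional complex
representation of the group `G`. -/
def IsIrrChar (G : Type) [Group G] (χ : G → ℂ) : Prop :=
  ∃ V : FDRep ℂ G, Simple V ∧ FDRep.character V = χ

/-- The value of a class function `χ` on a conjugacy class `c` (via a representative;
this is well-defined for class functions, in particular for irreducible characters). -/
noncomputable def classVal {G : Type} [Group G] (χ : G → ℂ) (c : ConjClasses G) : ℂ :=
  χ (Quotient.out c)

open Module

theorem geom_sum_eq_zero_of_pow_eq_one {K : Type*} [Field K] {x : K} {n : ℕ} (hx : x ^ n = 1)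
    (hx1 : x ≠ 1) : ∑ k ∈ Finset.range n, x ^ k = 0 := by
  rw [geom_sum_eq hx1, hx, sub_self, zero_div]

theorem Complex.eq_one_of_norm_le_one_of_re {z : ℂ} (hz : ‖z‖ ≤ 1) (hre : 1 ≤ z.re) : z = 1 := by
  have h1 : z.re = 1 := le_antisymm ((Complex.re_le_norm z).trans hz) hre
  have h2 : z.re * z.re + z.im * z.im ≤ 1 := by
    have h := Complex.normSq_eq_norm_sq z
    rw [Complex.normSq_apply] at h
    rw [h]
    nlinarith [norm_nonneg z]
  have h3 : z.im = 0 := by nlinarith [mul_self_nonneg z.im]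
  exact Complex.ext h1 h3

theorem LinearMap.exists_eigenvalue_multiplicities {V : Type*} [AddCommGroup V] [Module ℂ V]
    [FiniteDimensional ℂ V] (T : V →ₗ[ℂ] V) {n : ℕ} (hn : 0 < n) (hT : T ^ n = 1) {ζ : ℂ}
    (hζ : IsPrimitiveRoot ζ n) :
    ∃ m : ℕ → ℕ, (∀ j : ℕ, trace ℂ V (T ^ j) = ∑ k ∈ Finset.range n, (m k : ℂ) * ζ ^ (j * k)) ∧
      (trace ℂ V T = trace ℂ V 1 → T = 1) := by
  have hn0 : (n : ℂ) ≠ 0 := by exact_mod_cast hn.ne'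
  have hζ0 : ζ ≠ 0 := hζ.ne_zero hn.ne'
  set P : ℕ → (V →ₗ[ℂ] V) := fun k =>
    (n : ℂ)⁻¹ • ∑ i ∈ Finset.range n, (ζ⁻¹ ^ (i * k)) • T ^ i with hP
  have hTP (k : ℕ) : T * P k = ζ ^ k • P k := by
    have hshift : ∑ i ∈ Finset.range n, (ζ⁻¹ ^ ((i + 1) * k)) • T ^ (i + 1) =
        ∑ i ∈ Finset.range n, (ζ⁻¹ ^ (i * k)) • T ^ i := by
      have h := Finset.sum_range_succ' (fun i => (ζ⁻¹ ^ (i * k)) • T ^ i) n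
      rw [Finset.sum_range_succ] at h
      have h1 : ζ⁻¹ ^ (n * k) = 1 := by rw [pow_mul, inv_pow, hζ.pow_eq_one]; simp
      simp only [h1, hT, zero_mul, pow_zero] at h
      exact (add_right_cancel h).symm
    have h : T * ∑ i ∈ Finset.range n, (ζ⁻¹ ^ (i * k)) • T ^ i =
        ζ ^ k • ∑ i ∈ Finset.range n, (ζ⁻¹ ^ ((i + 1) * k)) • T ^ (i + 1) := by
      rw [Finset.mul_sum, Finset.smul_sum]
      refine Finset.sum_congr rfl fun i _ => ?_
      rw [mul_smul_comm, ← pow_succ', smul_smul]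
      congr 1
      rw [add_mul, one_mul, pow_add, mul_left_comm, ← mul_pow, mul_inv_cancel₀ hζ0, one_pow,
        mul_one]
    simp only [hP]
    rw [mul_smul_comm, h, hshift, smul_comm]
  have hTjP (k j : ℕ) : T ^ j * P k = ζ ^ (j * k) • P k := by
    induction j with
    | zero => simp
    | succ j ih =>
      rw [pow_succ', mul_assoc, ih, mul_smul_comm, hTP, smul_smul, ← pow_add]
      congr 2
      ring
  have hPP (k : ℕ) : IsIdempotentElem (P k) := by
    have h : P k * P k = (n : ℂ)⁻¹ • ∑ i ∈ Finset.range n, (ζ⁻¹ ^ (i * k)) • (T ^ i * P k) := by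
      nth_rewrite 1 [hP]
      simp only [smul_mul_assoc, Finset.sum_mul]
    rw [IsIdempotentElem, h]
    simp only [hTjP, smul_smul, ← mul_pow, inv_mul_cancel₀ hζ0, one_pow, one_smul]
    rw [Finset.sum_const, Finset.card_range, ← Nat.cast_smul_eq_nsmul ℂ, smul_smul,
      inv_mul_cancel₀ hn0, one_smul]
  have hsum : ∑ k ∈ Finset.range n, P k = 1 := by
    simp only [hP]
    rw [← Finset.smul_sum, Finset.sum_comm]
    simp only [← Finset.sum_smul]
    rw [Finset.sum_eq_single 0]
    · simp only [zero_mul, pow_zero, Finset.sum_const, Finset.card_range, nsmul_eq_mul, mul_one]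
      rw [smul_smul, inv_mul_cancel₀ hn0, one_smul]
    · intro i hi hi0
      have hi' := Finset.mem_range.mp hi
      simp only [pow_mul]
      rw [geom_sum_eq_zero_of_pow_eq_one, zero_smul]
      · rw [← pow_mul, mul_comm, pow_mul, inv_pow, hζ.pow_eq_one]; simp
      · rw [inv_pow, Ne, inv_eq_one]
        exact hζ.pow_ne_one_of_pos_of_lt hi0 hi'
    · intro h; exact absurd (Finset.mem_range.mpr hn) h
  have hTj (j : ℕ) : T ^ j = ∑ k ∈ Finset.range n, ζ ^ (j * k) • P k := by
    rw [← mul_one (T ^ j), ← hsum, Finset.mul_sum]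
    exact Finset.sum_congr rfl fun k _ => hTjP k j
  have htr (k : ℕ) : trace ℂ V (P k) = (finrank ℂ (range (P k)) : ℂ) :=
    (LinearMap.IsIdempotentElem.isProj_range _ (hPP k)).trace
  have hform (j : ℕ) : trace ℂ V (T ^ j) =
      ∑ k ∈ Finset.range n, (finrank ℂ (range (P k)) : ℂ) * ζ ^ (j * k) := by
    rw [hTj, map_sum]
    refine Finset.sum_congr rfl fun k _ => ?_
    rw [map_smul, htr, smul_eq_mul, mul_comm]
  refine ⟨fun k => finrank ℂ (range (P k)), hform, fun h => ?_⟩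
  have h0 := hform 0
  have h1 := hform 1
  rw [pow_zero, ← h, ← pow_one T, h1] at h0
  simp only [one_mul, zero_mul, pow_zero, mul_one] at h0
  have hnorm (k : ℕ) : ‖ζ ^ k‖ ≤ 1 := by
    rw [norm_pow, hζ.norm'_eq_one hn.ne', one_pow]
  have hre := congrArg Complex.re h0
  simp only [Complex.re_sum, ← Complex.ofReal_natCast, Complex.re_ofReal_mul,
    Complex.ofReal_re] at hre
  have hle : ∀ k ∈ Finset.range n, (finrank ℂ (range (P k)) : ℝ) * (ζ ^ k).re ≤
      (finrank ℂ (range (P k)) : ℝ) := fun k _ => by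
    have := (Complex.re_le_norm (ζ ^ k)).trans (hnorm k)
    exact mul_le_of_le_one_right (Nat.cast_nonneg _) this
  have heq := (Finset.sum_eq_sum_iff_of_le hle).mp hre
  have hT1 := hTj 1
  rw [pow_one] at hT1
  rw [hT1, ← hsum]
  refine Finset.sum_congr rfl fun k hk => ?_
  rcases Nat.eq_zero_or_pos (finrank ℂ (range (P k))) with h2 | h2
  · have : P k = 0 :=
      LinearMap.IsIdempotentElem.eq_zero_of_trace_eq_zero (hPP k) (by rw [htr, h2, Nat.cast_zero])
    rw [this, smul_zero]
  · have h3 := heq k hk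
    have h4 : (0 : ℝ) < finrank ℂ (range (P k)) := by exact_mod_cast h2
    have h5 : ζ ^ k = 1 := Complex.eq_one_of_norm_le_one_of_re (hnorm k) (by nlinarith)
    rw [one_mul, h5, one_smul]

section
variable {G : Type} [Group G]

theorem IsIrrChar.mul_comm {χ : G → ℂ} (hχ : IsIrrChar G χ) (g h : G) : χ (g * h) = χ (h * g) := by
  obtain ⟨V, -, rfl⟩ := hχ
  exact V.char_mul_comm h g

theorem IsIrrChar.eq_of_isConj {χ : G → ℂ} (hχ : IsIrrChar G χ) {g h : G} (hgh : IsConj g h) :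
    χ g = χ h := by
  obtain ⟨V, -, rfl⟩ := hχ
  obtain ⟨c, rfl⟩ := isConj_iff.mp hgh
  exact (V.char_conj g c).symm

theorem FDRep.ρ_eq_one_of_character_eq [Finite G] (V : FDRep ℂ G) {g : G}
    (h : V.character g = V.character 1) : V.ρ g = 1 := by
  have hn : 0 < orderOf g := orderOf_pos g
  obtain ⟨m, -, hm⟩ := LinearMap.exists_eigenvalue_multiplicities (V.ρ g) hn
    (by rw [← map_pow, pow_orderOf_eq_one, map_one]) (Complex.isPrimitiveRoot_exp _ hn.ne')
  exact hm (by rw [← map_one V.ρ]; exact h)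

theorem IsIrrChar.mul_of_eq_one [Finite G] {χ : G → ℂ} (hχ : IsIrrChar G χ) {n : G}
    (hn : χ n = χ 1) (g : G) : χ (g * n) = χ g := by
  obtain ⟨V, -, rfl⟩ := hχ
  have := V.ρ_eq_one_of_character_eq hn
  simp [FDRep.character, this]

theorem IsIrrChar.exists_multiplicities [Finite G] {χ : G → ℂ} (hχ : IsIrrChar G χ) {g : G} {n : ℕ}
    (hn : 0 < n) (hg : χ (g ^ n) = χ 1) {ζ : ℂ} (hζ : IsPrimitiveRoot ζ n) :
    ∃ m : ℕ → ℕ, ∀ j : ℕ, χ (g ^ j) = ∑ k ∈ Finset.range n, (m k : ℂ) * ζ ^ (j * k) := by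
  obtain ⟨V, -, rfl⟩ := hχ
  obtain ⟨m, hm, -⟩ := LinearMap.exists_eigenvalue_multiplicities (V.ρ g) hn
    (by rw [← map_pow, V.ρ_eq_one_of_character_eq hg]) hζ
  exact ⟨m, fun j => by rw [← hm j, ← map_pow]; rfl⟩

theorem IsIrrChar.one_pos {χ : G → ℂ} (hχ : IsIrrChar G χ) : ∃ n : ℕ, 0 < n ∧ χ 1 = n := by
  obtain ⟨V, hV, rfl⟩ := hχ
  refine ⟨finrank ℂ V, ?_, V.char_one⟩
  rw [Module.finrank_pos_iff, ← not_subsingleton_iff_nontrivial]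
  intro hs
  apply id_nonzero V
  ext x
  exact Subsingleton.elim _ _

theorem isIrrChar_one [Finite G] : IsIrrChar G 1 := by
  have := Fintype.ofFinite G
  refine ⟨FDRep.of (Representation.trivial ℂ G ℂ), ?_, ?_⟩
  · rw [FDRep.simple_iff_char_is_norm_one]
    simp [FDRep.character]
  · ext g
    simp [FDRep.character]

theorem isIrrChar_of_isIrreducible [Finite G] {V : Type} [AddCommGroup V] [Module ℂ V]
    [FiniteDimensional ℂ V] (ρ : Representation ℂ G V) [ρ.IsIrreducible] :
    IsIrrChar G ρ.character := by
  have := Fintype.ofFinite G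
  refine ⟨FDRep.of ρ, ?_, rfl⟩
  rw [FDRep.simple_iff_char_is_norm_one]
  have := invertibleOfNonzero (NeZero.ne (Nat.card G : ℂ))
  have h := Representation.char_orthonormal ρ ρ
  rw [if_pos ⟨Representation.Equiv.refl ρ⟩] at h
  rw [inv_mul_eq_one₀ (NeZero.ne _)] at h
  exact h.symm

theorem IsIrrChar.sum_mul_inv [Fintype G] {χ ψ : G → ℂ} (hχ : IsIrrChar G χ) (hψ : IsIrrChar G ψ) :
    ∑ g, χ g * ψ g⁻¹ = if χ = ψ then (Nat.card G : ℂ) else 0 := by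
  obtain ⟨V, hV, rfl⟩ := hχ
  obtain ⟨W, hW, rfl⟩ := hψ
  have hG : (Nat.card G : ℂ) ≠ 0 := NeZero.ne _
  have := invertibleOfNonzero hG
  have h := FDRep.char_orthonormal V W
  split_ifs with h1
  · rw [h1] at h ⊢
    have h' := FDRep.char_orthonormal W W
    rw [if_pos ⟨Iso.refl W⟩, inv_mul_eq_one₀ hG] at h'
    exact h'.symm
  · rw [if_neg (fun ⟨i⟩ => h1 (FDRep.char_iso i))] at h
    exact (mul_eq_zero.mp h).resolve_left (inv_ne_zero hG)

theorem IsIrrChar.inv_eq_star [Finite G] {χ : G → ℂ} (hχ : IsIrrChar G χ) (g : G) :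
    χ g⁻¹ = star (χ g) := by
  have hn : 0 < orderOf g := orderOf_pos g
  have hζ := Complex.isPrimitiveRoot_exp _ hn.ne'
  obtain ⟨m, hm⟩ := hχ.exists_multiplicities hn (by rw [pow_orderOf_eq_one]) hζ
  set ζ := Complex.exp (2 * Real.pi * Complex.I / orderOf g)
  have h1 := hm 1
  have h2 := hm (orderOf g - 1)
  have hinv : g ^ (orderOf g - 1) = g⁻¹ := by
    rw [eq_inv_iff_mul_eq_one, ← pow_succ, Nat.sub_add_cancel hn, pow_orderOf_eq_one]
  rw [hinv] at h2
  rw [pow_one] at h1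
  rw [h1, h2, star_sum]
  refine Finset.sum_congr rfl fun k _ => ?_
  have hz : ζ ^ (orderOf g - 1) = star ζ := by
    have : star ζ = ζ⁻¹ := (Complex.inv_eq_conj (hζ.norm'_eq_one hn.ne')).symm
    rw [this]
    exact eq_inv_of_mul_eq_one_left (by rw [← pow_succ, Nat.sub_add_cancel hn, hζ.pow_eq_one])
  rw [pow_mul, hz, star_mul', star_pow, one_mul, star_natCast]

end

section
variable {G : Type} [Group G]

theorem Representation.IsIrreducible.sum_smul_eq_zero [Fintype G] {V : Type} [AddCommGroup V]
    [Module ℂ V] [FiniteDimensional ℂ V] (ρ : Representation ℂ G V) [ρ.IsIrreducible] {f : G → ℂ}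
    (hf : ∀ g h, f (g * h) = f (h * g)) (h : ∑ g, f g * ρ.character g = 0) :
    ∑ g, f g • ρ g = 0 := by
  have hcomm : ∀ x : G, (∑ g, f g • ρ g) * ρ x = ρ x * ∑ g, f g • ρ g := by
    intro x
    rw [Finset.sum_mul, Finset.mul_sum]
    refine Fintype.sum_equiv (MulAut.conj x⁻¹).toEquiv _ _ fun g => ?_
    have : f (x⁻¹ * g * x) = f g := by rw [hf, mul_inv_cancel_left]
    have e : x * (x⁻¹ * g * x) = g * x := by group
    simp [this, ← map_mul, e]
  let T : Representation.IntertwiningMap ρ ρ :=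
    ⟨∑ g, f g • ρ g, fun x => by simpa [Module.End.mul_eq_comp] using hcomm x⟩
  obtain ⟨c, hc⟩ :=
    (Representation.IsIrreducible.algebraMap_intertwiningMap_bijective_of_isAlgClosed (ρ := ρ)).2 T
  have hc' : ∑ g, f g • ρ g = c • (1 : V →ₗ[ℂ] V) := by
    have := congrArg Representation.IntertwiningMap.toLinearMap hc
    exact this.symm
  have htr := congrArg (LinearMap.trace ℂ V) hc'
  simp only [map_sum, map_smul, LinearMap.trace_one, smul_eq_mul] at htr
  have h0 : c * (finrank ℂ V : ℂ) = 0 := by rw [← htr, ← h]; rfl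
  rw [hc']
  rcases mul_eq_zero.mp h0 with h0 | h0
  · rw [h0, zero_smul]
  · have : finrank ℂ V = 0 := by exact_mod_cast h0
    have := finrank_zero_iff.mp this
    ext x
    exact Subsingleton.elim _ _

theorem Representation.exists_isIrreducible_subrepresentation {V : Type} [AddCommGroup V]
    [Module ℂ V] [FiniteDimensional ℂ V] {ρ : Representation ℂ G V} (B : Subrepresentation ρ)
    (hB : B ≠ ⊥) : ∃ C : Subrepresentation ρ, C ≤ B ∧ C ≠ ⊥ ∧ C.toRepresentation.IsIrreducible := by
  obtain ⟨C, ⟨hCB, hC⟩, hmin⟩ := WellFounded.has_min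
    (InvImage.wf (fun C : Subrepresentation ρ => finrank ℂ C.toSubmodule) wellFounded_lt)
    {C | C ≤ B ∧ C ≠ ⊥} ⟨B, le_rfl, hB⟩
  refine ⟨C, hCB, hC, ?_⟩
  have hC' : C.toSubmodule ≠ ⊥ := fun h => hC (Subrepresentation.toSubmodule_injective h)
  refine { exists_pair_ne := ⟨⊥, ⊤, fun h => ?_⟩, eq_bot_or_eq_top := fun D => ?_ }
  · have h1 : (⊥ : Submodule ℂ C.toSubmodule) = ⊤ :=
      congrArg Subrepresentation.toSubmodule h
    apply hC'
    rw [eq_bot_iff]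
    intro x hx
    have : (⟨x, hx⟩ : C.toSubmodule) ∈ (⊥ : Submodule ℂ C.toSubmodule) := h1 ▸ Submodule.mem_top
    simpa using this
  · by_contra! hD
    obtain ⟨hD1, hD2⟩ := hD
    let D' : Subrepresentation ρ := ⟨D.toSubmodule.map C.toSubmodule.subtype, by
      rintro g _ ⟨x, hx, rfl⟩
      exact ⟨_, D.apply_mem_toSubmodule g hx, rfl⟩⟩
    have hfin : finrank ℂ D'.toSubmodule = finrank ℂ D.toSubmodule :=
      Submodule.finrank_map_subtype_eq _ _
    refine hmin D' ⟨?_, ?_⟩ ?_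
    · rintro _ ⟨x, -, rfl⟩
      exact hCB x.2
    · intro h
      apply hD1
      apply Subrepresentation.toSubmodule_injective
      have h1 : D.toSubmodule.map C.toSubmodule.subtype = ⊥ :=
        congrArg Subrepresentation.toSubmodule h
      exact Submodule.map_injective_of_injective C.toSubmodule.subtype_injective
        (h1.trans (Submodule.map_bot _).symm)
    · show finrank ℂ D'.toSubmodule < finrank ℂ C.toSubmodule
      rw [hfin]
      exact Submodule.finrank_lt fun h => hD2 (Subrepresentation.toSubmodule_injective h)

theorem Representation.sum_smul_eq_zero [Fintype G] {f : G → ℂ}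
    (hf : ∀ g h, f (g * h) = f (h * g)) (h : ∀ χ, IsIrrChar G χ → ∑ g, f g * χ g = 0)
    {V : Type} [AddCommGroup V] [Module ℂ V] [FiniteDimensional ℂ V] (ρ : Representation ℂ G V) :
    ∑ g, f g • ρ g = 0 := by
  have hcomm : ∀ x : G, (∑ g, f g • ρ g) * ρ x = ρ x * ∑ g, f g • ρ g := by
    intro x
    rw [Finset.sum_mul, Finset.mul_sum]
    refine Fintype.sum_equiv (MulAut.conj x⁻¹).toEquiv _ _ fun g => ?_
    have : f (x⁻¹ * g * x) = f g := by rw [hf, mul_inv_cancel_left]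
    have e : x * (x⁻¹ * g * x) = g * x := by group
    simp [this, ← map_mul, e]
  let A : Subrepresentation ρ := ⟨LinearMap.ker (∑ g, f g • ρ g), fun x v hv => by
    have := congrArg (fun T => T v) (hcomm x)
    simp only [Module.End.mul_apply] at this
    rw [LinearMap.mem_ker, this, LinearMap.mem_ker.mp hv, map_zero]⟩
  obtain ⟨B, hAB⟩ := exists_isCompl A
  have hB : B = ⊥ := by
    by_contra hB
    obtain ⟨C, hCB, hC, hirr⟩ := Representation.exists_isIrreducible_subrepresentation B hB
    have h1 := hirr.sum_smul_eq_zero _ hf (h _ (isIrrChar_of_isIrreducible C.toRepresentation))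
    have hCA : C ≤ A := by
      intro x hx
      have h2 := congrArg (fun T => ((T ⟨x, hx⟩ : C.toSubmodule) : V)) h1
      simp only [LinearMap.sum_apply, LinearMap.smul_apply, LinearMap.zero_apply,
        Submodule.coe_sum, Submodule.coe_smul] at h2
      show x ∈ LinearMap.ker (∑ g, f g • ρ g)
      rw [LinearMap.mem_ker]
      rw [LinearMap.sum_apply]
      exact h2
    exact hC (eq_bot_iff.mpr (hAB.disjoint hCA hCB))
  have hA : A = ⊤ := by simpa [hB] using hAB.sup_eq_top
  exact LinearMap.ker_eq_top.mp (congrArg Subrepresentation.toSubmodule hA)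

theorem eq_zero_of_forall_isIrrChar [Fintype G] {f : G → ℂ}
    (hf : ∀ g h, f (g * h) = f (h * g)) (h : ∀ χ, IsIrrChar G χ → ∑ g, f g * χ g = 0) : f = 0 := by
  let ρ : Representation ℂ G (G → ℂ) :=
    { toFun := fun g => LinearMap.funLeft ℂ ℂ (· * g)
      map_one' := by ext; simp [LinearMap.funLeft_apply]
      map_mul' := fun g h => by ext; simp [LinearMap.funLeft_apply, mul_assoc] }
  have h1 := Representation.sum_smul_eq_zero hf h ρ
  classical
  ext g
  have h2 := congrArg (fun T => T (Pi.single 1 1) g⁻¹) h1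
  have h3 : ∀ k : G, g⁻¹ * k = 1 ↔ k = g := fun k => by rw [inv_mul_eq_one, eq_comm]
  simpa [ρ, LinearMap.sum_apply, LinearMap.funLeft_apply, Pi.single_apply, h3] using h2
end

/-- The irreducible characters of `G`. -/
abbrev IrrChar (G : Type) [Group G] := {χ : G → ℂ // IsIrrChar G χ}

section
variable {G : Type} [Group G]

theorem card_conjugatesOf_mul_card_centralizer [Finite G] (g : G) :
    Nat.card (conjugatesOf g) * Nat.card (Subgroup.centralizer {g}) = Nat.card G := by
  have := Fintype.ofFinite G
  classical
  rw [Subgroup.nat_card_centralizer_nat_card_stabilizer]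
  have h := MulAction.card_orbit_mul_card_stabilizer_eq_card_group (ConjAct G) g
  rw [← Nat.card_eq_fintype_card, ← Nat.card_eq_fintype_card, ← Nat.card_eq_fintype_card] at h
  have h2 : MulAction.orbit (ConjAct G) g = conjugatesOf g := by
    rw [ConjAct.orbit_eq_carrier_conjClasses]; rfl
  rw [← h2, h]
  rfl

theorem IsIrrChar.sum_mul_star [Fintype G] {χ ψ : G → ℂ} (hχ : IsIrrChar G χ)
    (hψ : IsIrrChar G ψ) :
    ∑ g, χ g * star (ψ g) = if χ = ψ then (Nat.card G : ℂ) else 0 := by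
  simp_rw [← hχ.sum_mul_inv hψ, hψ.inv_eq_star]

theorem IrrChar.linearIndependent [Finite G] :
    LinearIndependent ℂ (fun χ : IrrChar G => χ.1) := by
  have := Fintype.ofFinite G
  rw [linearIndependent_iff']
  intro s c hc ψ hψ
  have h : ∑ g, (∑ χ ∈ s, c χ • χ.1) g * star (ψ.1 g) = 0 := by
    rw [hc]
    simp
  simp only [Finset.sum_apply, Pi.smul_apply, smul_eq_mul, Finset.sum_mul, mul_assoc] at h
  rw [Finset.sum_comm] at h
  simp only [← Finset.mul_sum, (Subtype.prop _ : IsIrrChar G _).sum_mul_star ψ.2,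
    ← Subtype.ext_iff] at h
  simpa [hψ] using h

instance IrrChar.finite [Finite G] : Finite (IrrChar G) :=
  IrrChar.linearIndependent.finite

theorem IrrChar.expansion [Fintype G] [Fintype (IrrChar G)] {f : G → ℂ}
    (hf : ∀ g h, f (g * h) = f (h * g)) (g : G) :
    ∑ χ : IrrChar G, (∑ x, f x * star (χ.1 x)) * χ.1 g = Nat.card G * f g := by
  let F : G → ℂ := fun g =>
    ∑ χ : IrrChar G, (∑ x, f x * star (χ.1 x)) * χ.1 g⁻¹ - Nat.card G * f g⁻¹
  have hF : F = 0 := by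
    apply eq_zero_of_forall_isIrrChar
    · intro g h
      have h1 : f (h⁻¹ * g⁻¹) = f (g⁻¹ * h⁻¹) := hf _ _
      have h2 : ∀ χ : IrrChar G, χ.1 (h⁻¹ * g⁻¹) = χ.1 (g⁻¹ * h⁻¹) := fun χ => χ.2.mul_comm _ _
      simp only [F, mul_inv_rev, h1, h2]
    · intro ψ hψ
      rw [← Equiv.sum_comp (Equiv.inv G)]
      simp only [F, Equiv.inv_apply, inv_inv, sub_mul, Finset.sum_sub_distrib, Finset.sum_mul]
      rw [Finset.sum_comm]
      have e : ∀ χ : IrrChar G, ∑ y, ∑ x, f x * star (χ.1 x) * χ.1 y * ψ y⁻¹ =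
          (∑ x, f x * star (χ.1 x)) * ∑ y, χ.1 y * star (ψ y) := by
        intro χ
        rw [Finset.sum_mul_sum, Finset.sum_comm]
        simp only [hψ.inv_eq_star, mul_assoc]
      simp only [e]
      simp only [hψ.inv_eq_star, mul_assoc, ← Finset.mul_sum]
      rw [Finset.sum_eq_single ⟨ψ, hψ⟩]
      · rw [hψ.sum_mul_star hψ, if_pos rfl, mul_comm, sub_self]
      · intro χ _ hχ
        rw [χ.2.sum_mul_star hψ, if_neg (fun h => hχ (Subtype.ext h)), mul_zero]
      · simp
  have := congrFun hF g⁻¹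
  simpa [F, sub_eq_zero] using this

open Classical in
theorem IrrChar.sum_mul_star [Finite G] [Fintype (IrrChar G)] (g h : G) :
    ∑ χ : IrrChar G, χ.1 g * star (χ.1 h) =
      if IsConj g h then (Nat.card (Subgroup.centralizer {h}) : ℂ) else 0 := by
  have := Fintype.ofFinite G
  have key := IrrChar.expansion (f := fun x => if IsConj x h then (1 : ℂ) else 0) (fun x y => by
    have : IsConj (x * y) (y * x) := isConj_iff.mpr ⟨y, by group⟩
    exact if_congr ⟨fun h => this.symm.trans h, fun h => this.trans h⟩ rfl rfl) g
  have h1 : ∀ χ : IrrChar G, ∑ x, (if IsConj x h then (1 : ℂ) else 0) * star (χ.1 x) =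
      Nat.card (conjugatesOf h) * star (χ.1 h) := by
    intro χ
    have : ∀ x, (if IsConj x h then (1 : ℂ) else 0) * star (χ.1 x) =
        if x ∈ conjugatesOf h then star (χ.1 h) else 0 := by
      intro x
      by_cases hx : IsConj x h
      · rw [if_pos hx, if_pos (show x ∈ conjugatesOf h from hx.symm), χ.2.eq_of_isConj hx, one_mul]
      · rw [if_neg hx, if_neg (show x ∉ conjugatesOf h from fun h' => hx (IsConj.symm h')),
          zero_mul]
    rw [Finset.sum_congr rfl (fun x _ => this x), ← Finset.sum_filter, Finset.sum_const,
      nsmul_eq_mul, Nat.card_eq_fintype_card, Fintype.card_subtype]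
  simp only [h1] at key
  have hc : (Nat.card (conjugatesOf h) : ℂ) ≠ 0 := by
    have : Nonempty (conjugatesOf h) := ⟨⟨h, mem_conjugatesOf_self⟩⟩
    exact_mod_cast Nat.card_pos.ne'
  apply mul_left_cancel₀ hc
  have h2 : (Nat.card (conjugatesOf h) : ℂ) * ∑ χ : IrrChar G, χ.1 g * star (χ.1 h) =
      Nat.card G * if IsConj g h then (1 : ℂ) else 0 := by
    rw [← key, Finset.mul_sum]
    exact Finset.sum_congr rfl fun χ _ => by ring
  rw [h2, ← card_conjugatesOf_mul_card_centralizer h]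
  split_ifs <;> push_cast <;> ring

theorem IrrChar.isConj_of_forall_eq [Finite G] {g h : G} (H : ∀ χ, IsIrrChar G χ → χ g = χ h) :
    IsConj g h := by
  classical
  have := Fintype.ofFinite (IrrChar G)
  by_contra hc
  have h1 := IrrChar.sum_mul_star g h
  have h2 := IrrChar.sum_mul_star h h
  rw [if_neg hc] at h1
  rw [if_pos (IsConj.refl h)] at h2
  have : (Nat.card (Subgroup.centralizer {h}) : ℂ) = 0 := by
    rw [← h1, ← h2]
    exact Finset.sum_congr rfl fun χ _ => by rw [H _ χ.2]
  exact Nat.card_pos.ne' (by exact_mod_cast this)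

theorem IsIrrChar.norm_le [Finite G] {χ : G → ℂ} (hχ : IsIrrChar G χ) (g : G) :
    ‖χ g‖ ≤ ‖χ 1‖ := by
  have hn : 0 < orderOf g := orderOf_pos g
  have hζ := Complex.isPrimitiveRoot_exp _ hn.ne'
  obtain ⟨m, hm⟩ := hχ.exists_multiplicities hn (by rw [pow_orderOf_eq_one]) hζ
  have h1 := hm 1
  have h0 := hm 0
  simp only [pow_one, one_mul, pow_zero, zero_mul, mul_one] at h0 h1
  rw [h1, h0]
  refine (norm_sum_le _ _).trans (le_of_eq ?_)
  rw [← Nat.cast_sum, Complex.norm_natCast, Nat.cast_sum]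
  refine Finset.sum_congr rfl fun k _ => ?_
  rw [norm_mul, norm_pow, hζ.norm'_eq_one hn.ne', one_pow, mul_one, Complex.norm_natCast]

theorem IsIrrChar.isIntegral [Finite G] {χ : G → ℂ} (hχ : IsIrrChar G χ) (g : G) :
    IsIntegral ℤ (χ g) := by
  have hn : 0 < orderOf g := orderOf_pos g
  have hζ := Complex.isPrimitiveRoot_exp _ hn.ne'
  obtain ⟨m, hm⟩ := hχ.exists_multiplicities hn (by rw [pow_orderOf_eq_one]) hζ
  have h1 := hm 1
  rw [pow_one] at h1
  rw [h1]
  refine IsIntegral.sum _ fun k _ => ?_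
  refine IsIntegral.mul ?_ ((hζ.isIntegral hn).pow _)
  exact_mod_cast (isIntegral_algebraMap (R := ℤ) (A := ℂ) (x := (m k : ℤ)))

/-- Algebraically conjugate powers: equalities of character values between two groups are preserved
by raising the elements to a power coprime to a common exponent. -/
theorem IsIrrChar.pow_eq_pow_of_coprime {H : Type} [Group H] [Finite G] [Finite H] {χ : G → ℂ}
    {ψ : H → ℂ} (hχ : IsIrrChar G χ) (hψ : IsIrrChar H ψ) {g : G} {h : H} {r s : ℕ} (hr : 0 < r)
    (hg : χ (g ^ r) = χ 1) (hh : ψ (h ^ r) = ψ 1) (hgh : χ g = ψ h) (hs : s.Coprime r) :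
    χ (g ^ s) = ψ (h ^ s) := by
  have hζ := Complex.isPrimitiveRoot_exp r hr.ne'
  set ζ := Complex.exp (2 * Real.pi * Complex.I / r)
  obtain ⟨m, hm⟩ := hχ.exists_multiplicities hr hg hζ
  obtain ⟨m', hm'⟩ := hψ.exists_multiplicities hr hh hζ
  let P : Polynomial ℤ :=
    ∑ k ∈ Finset.range r, Polynomial.C ((m k : ℤ) - m' k) * Polynomial.X ^ k
  have hP : ∀ j, Polynomial.aeval (ζ ^ j) P = χ (g ^ j) - ψ (h ^ j) := by
    intro j
    rw [hm, hm', ← Finset.sum_sub_distrib]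
    simp only [P, map_sum, map_mul, map_pow, Polynomial.aeval_X, Polynomial.aeval_C]
    refine Finset.sum_congr rfl fun k _ => ?_
    simp [pow_mul, sub_mul]
  have h1 : Polynomial.aeval ζ P = 0 := by
    have := hP 1
    rwa [pow_one, pow_one, pow_one, hgh, sub_self] at this
  have h2 : minpoly ℤ ζ ∣ P := minpoly.isIntegrallyClosed_dvd (hζ.isIntegral hr) h1
  rw [hζ.minpoly_eq_pow_coprime hs] at h2
  obtain ⟨Q, hQ⟩ := h2
  have h3 := hP s
  rw [hQ, map_mul, minpoly.aeval, zero_mul] at h3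
  exact (sub_eq_zero.mp h3.symm)

end

section
variable {G : Type} [Group G]

theorem IsIrrChar.classVal_mk {χ : G → ℂ} (hχ : IsIrrChar G χ) (g : G) :
    classVal χ (ConjClasses.mk g) = χ g :=
  hχ.eq_of_isConj (ConjClasses.mk_eq_mk_iff_isConj.mp (Quotient.out_eq (ConjClasses.mk g)))

theorem classVal_one (c : ConjClasses G) : classVal 1 c = 1 := rfl

/-- The order of the centralizer of an element of the conjugacy class `c`. -/
noncomputable def ConjClasses.cardCentralizer (c : ConjClasses G) : ℕ :=
  Nat.card (Subgroup.centralizer {Quotient.out c})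

theorem ConjClasses.cardCentralizer_pos [Finite G] (c : ConjClasses G) : 0 < c.cardCentralizer :=
  Nat.card_pos

theorem ConjClasses.cardCentralizer_ne_zero [Finite G] (c : ConjClasses G) :
    (c.cardCentralizer : ℂ) ≠ 0 := by
  exact_mod_cast c.cardCentralizer_pos.ne'

theorem ConjClasses.cardCentralizer_one [Finite G] :
    (ConjClasses.mk (1 : G)).cardCentralizer = Nat.card G := by
  have h : Quotient.out (ConjClasses.mk (1 : G)) = 1 := by
    have := ConjClasses.mk_eq_mk_iff_isConj.mp (Quotient.out_eq (ConjClasses.mk (1 : G)))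
    exact isConj_one_left.mp this
  rw [ConjClasses.cardCentralizer, h]
  have : Subgroup.centralizer ({1} : Set G) = ⊤ := by simp
  rw [this, Subgroup.card_top]

theorem sum_mk_eq_sum_conjClasses [Fintype G] [Fintype (ConjClasses G)] (F : ConjClasses G → ℂ) :
    ∑ g : G, F (ConjClasses.mk g) = ∑ c, (Nat.card G : ℂ) * (F c / c.cardCentralizer) := by
  classical
  rw [← Finset.sum_fiberwise_of_maps_to (t := Finset.univ) (g := ConjClasses.mk)
    (fun _ _ => Finset.mem_univ _)]
  refine Finset.sum_congr rfl fun c _ => ?_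
  rw [Finset.sum_congr rfl (g := fun _ => F c)
    (fun x hx => by rw [(Finset.mem_filter.mp hx).2]), Finset.sum_const, nsmul_eq_mul]
  have h1 : (Finset.univ.filter fun g : G => ConjClasses.mk g = c).card =
      Nat.card (conjugatesOf (Quotient.out c)) := by
    rw [Nat.card_eq_fintype_card, Fintype.card_subtype]
    congr 1
    ext x
    simp only [Finset.mem_filter, Finset.mem_univ, true_and]
    have h2 : ConjClasses.mk (Quotient.out c) = c := Quotient.out_eq c
    nth_rewrite 1 [← h2]
    rw [ConjClasses.mk_eq_mk_iff_isConj]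
    exact isConj_comm
  have h2 := card_conjugatesOf_mul_card_centralizer (Quotient.out c)
  rw [h1, ← h2]
  have h3 := c.cardCentralizer_ne_zero
  rw [ConjClasses.cardCentralizer] at *
  push_cast
  field_simp

open Classical in
theorem IsIrrChar.sum_classVal_mul_star [Finite G] [Fintype (ConjClasses G)] {χ ψ : G → ℂ}
    (hχ : IsIrrChar G χ) (hψ : IsIrrChar G ψ) :
    ∑ c, classVal χ c * star (classVal ψ c) / c.cardCentralizer = if χ = ψ then 1 else 0 := by
  have := Fintype.ofFinite G
  have h := hχ.sum_mul_star hψ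
  have h2 := sum_mk_eq_sum_conjClasses (fun c : ConjClasses G => classVal χ c * star (classVal ψ c))
  simp only [hχ.classVal_mk, hψ.classVal_mk] at h2
  rw [h, ← Finset.mul_sum] at h2
  have hG : (Nat.card G : ℂ) ≠ 0 := NeZero.ne _
  apply mul_left_cancel₀ hG
  rw [← h2]
  split_ifs <;> simp

open Classical in
theorem IrrChar.sum_classVal_mul_star [Finite G] [Fintype (IrrChar G)] (c d : ConjClasses G) :
    ∑ χ : IrrChar G, classVal χ.1 c * star (classVal χ.1 d) =
      if c = d then (d.cardCentralizer : ℂ) else 0 := by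
  have h := IrrChar.sum_mul_star (Quotient.out c) (Quotient.out d)
  simp only [classVal, h, ConjClasses.cardCentralizer]
  refine if_congr ?_ rfl rfl
  rw [← ConjClasses.mk_eq_mk_iff_isConj]
  have h1 : ConjClasses.mk (Quotient.out c) = c := Quotient.out_eq c
  have h2 : ConjClasses.mk (Quotient.out d) = d := Quotient.out_eq d
  rw [h1, h2]

theorem sum_inv_cardCentralizer [Finite G] [Fintype (ConjClasses G)] :
    ∑ c : ConjClasses G, (c.cardCentralizer : ℂ)⁻¹ = 1 := by
  classical
  have h := (isIrrChar_one (G := G)).sum_classVal_mul_star isIrrChar_one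
  simpa [classVal_one] using h

end

theorem Equiv.exists_extend_subtype_ne {α β : Type*} {a : α} {b : β}
    (e : {x // x ≠ a} ≃ {y // y ≠ b}) :
    ∃ e' : α ≃ β, e' a = b ∧ ∀ x (h : x ≠ a), e' x = e ⟨x, h⟩ := by
  classical
  refine ⟨(Equiv.optionSubtypeNe a).symm.trans
    ((Equiv.optionCongr e).trans (Equiv.optionSubtypeNe b)), ?_, fun x h => ?_⟩
  · simp
  · simp [Equiv.optionSubtypeNe_symm_of_ne h]

/-- Two character tables that agree up to one column are identical. -/
theorem exists_table_equiv_of_agree_off_column {G H : Type} [Group G] [Finite G] [Group H]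
    [Finite H] (Φ : IrrChar G ≃ IrrChar H) (c₀ : ConjClasses G) (d₀ : ConjClasses H)
    (σ : {c : ConjClasses G // c ≠ c₀} ≃ {d : ConjClasses H // d ≠ d₀})
    (h : ∀ (χ : IrrChar G) (c : {c : ConjClasses G // c ≠ c₀}),
      classVal χ.1 c.1 = classVal (Φ χ).1 (σ c).1) :
    ∃ (Φ' : IrrChar G ≃ IrrChar H) (σ' : ConjClasses G ≃ ConjClasses H),
      ∀ (χ : IrrChar G) (c : ConjClasses G), classVal χ.1 c = classVal (Φ' χ).1 (σ' c) := by
  classical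
  have := Fintype.ofFinite G
  have := Fintype.ofFinite H
  have := Fintype.ofFinite (IrrChar G)
  have := Fintype.ofFinite (IrrChar H)
  have := Fintype.ofFinite (ConjClasses G)
  have := Fintype.ofFinite (ConjClasses H)
  have hH : ∀ d e : ConjClasses H,
      ∑ χ : IrrChar G, classVal (Φ χ).1 d * star (classVal (Φ χ).1 e) =
      if d = e then (e.cardCentralizer : ℂ) else 0 := by
    intro d e
    have h1 := IrrChar.sum_classVal_mul_star d e
    rw [← Equiv.sum_comp Φ] at h1
    rw [h1]
    split_ifs <;> rfl
  have hz : ∀ c : {c : ConjClasses G // c ≠ c₀},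
      (c.1.cardCentralizer : ℂ) = (σ c).1.cardCentralizer := by
    intro c
    have h1 := hH (σ c).1 (σ c).1
    have h2 := IrrChar.sum_classVal_mul_star c.1 c.1
    rw [if_pos rfl] at h1 h2
    rw [← h1, ← h2]
    exact Finset.sum_congr rfl fun χ _ => by rw [h]
  have hz₀ : (c₀.cardCentralizer : ℂ) = d₀.cardCentralizer := by
    have h1 := sum_inv_cardCentralizer (G := G)
    have h2 := sum_inv_cardCentralizer (G := H)
    rw [Fintype.sum_eq_add_sum_subtype_ne _ c₀] at h1
    rw [Fintype.sum_eq_add_sum_subtype_ne _ d₀, ← Equiv.sum_comp σ] at h2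
    simp only [← hz] at h2
    rw [← h2] at h1
    exact inv_injective (add_right_cancel h1)
  obtain ⟨κ, hκ⟩ : ∃ κ : ℂ, ∀ χ : IrrChar G, classVal (Φ χ).1 d₀ = κ * classVal χ.1 c₀ := by
    have hF : ∀ c : ConjClasses G, c ≠ c₀ →
        ∑ ψ : IrrChar G, classVal ψ.1 c * star (classVal (Φ ψ).1 d₀) = 0 := by
      intro c hc
      have h1 := hH (σ ⟨c, hc⟩).1 d₀
      rw [if_neg (σ ⟨c, hc⟩).2] at h1
      rw [← h1]
      exact Finset.sum_congr rfl fun ψ _ => by rw [← h]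
    refine ⟨star ((∑ ψ : IrrChar G, classVal ψ.1 c₀ * star (classVal (Φ ψ).1 d₀)) /
      c₀.cardCentralizer), fun χ => ?_⟩
    apply star_injective
    have h1 : ∑ c, ∑ ψ : IrrChar G, star (classVal (Φ ψ).1 d₀) *
        (classVal ψ.1 c * star (classVal χ.1 c) / c.cardCentralizer) =
          star (classVal (Φ χ).1 d₀) := by
      rw [Finset.sum_comm]
      simp only [← Finset.mul_sum, (Subtype.prop _ : IsIrrChar G _).sum_classVal_mul_star χ.2,
        ← Subtype.ext_iff]
      simp
    rw [← h1, Finset.sum_eq_single c₀]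
    · rw [star_mul', star_star, Finset.sum_div, Finset.sum_mul]
      exact Finset.sum_congr rfl fun ψ _ => by ring
    · intro c _ hc
      have h2 := hF c hc
      have h3 : ∀ ψ : IrrChar G, star (classVal (Φ ψ).1 d₀) *
        (classVal ψ.1 c * star (classVal χ.1 c) / c.cardCentralizer) =
          classVal ψ.1 c * star (classVal (Φ ψ).1 d₀) *
            (star (classVal χ.1 c) / c.cardCentralizer) := fun ψ => by ring
      simp only [h3, ← Finset.sum_mul, h2, zero_mul]
    · simp
  have hκ1 : ‖κ‖ = 1 := by
    have h1 := hH d₀ d₀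
    have h2 := IrrChar.sum_classVal_mul_star c₀ c₀
    rw [if_pos rfl] at h1 h2
    simp only [hκ] at h1
    have h3 : κ * star κ * (c₀.cardCentralizer : ℂ) = c₀.cardCentralizer := by
      conv_rhs => rw [hz₀, ← h1]
      rw [← h2, Finset.mul_sum]
      exact Finset.sum_congr rfl fun χ _ => by rw [star_mul']; ring
    have h4 := mul_right_cancel₀ c₀.cardCentralizer_ne_zero (h3.trans (one_mul _).symm)
    have h5 := congrArg norm h4
    rw [norm_mul, norm_star, norm_one] at h5
    nlinarith [norm_nonneg κ]
  obtain ⟨σ', hσ0, hσ⟩ := Equiv.exists_extend_subtype_ne σ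
  by_cases hk : κ = 1
  · refine ⟨Φ, σ', fun χ c => ?_⟩
    by_cases hc : c = c₀
    · rw [hc, hσ0, hκ, hk, one_mul]
    · rw [hσ c hc, ← h]
  let τ : IrrChar H := ⟨1, isIrrChar_one⟩
  set ψ : IrrChar H := Φ ⟨1, isIrrChar_one⟩ with hψdef
  have hψ0 : classVal ψ.1 d₀ = κ := by rw [hκ, classVal_one, mul_one]
  have hψ1 : ∀ d, d ≠ d₀ → classVal ψ.1 d = 1 := by
    intro d hd
    have := h ⟨1, isIrrChar_one⟩ (σ.symm ⟨d, hd⟩)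
    rw [Equiv.apply_symm_apply] at this
    exact this.symm
  have hψτ : ψ ≠ τ := by
    intro e
    rw [e] at hψ0
    exact hk hψ0.symm
  have hz2 : κ = 1 - d₀.cardCentralizer := by
    have h1 := ψ.2.sum_classVal_mul_star τ.2
    rw [if_neg (fun e => hψτ (Subtype.ext e)), Fintype.sum_eq_add_sum_subtype_ne _ d₀] at h1
    have h2 := sum_inv_cardCentralizer (G := H)
    rw [Fintype.sum_eq_add_sum_subtype_ne _ d₀] at h2
    have h3 : ∑ d : {d // d ≠ d₀}, classVal ψ.1 d.1 * star (classVal τ.1 d.1) /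
        d.1.cardCentralizer = ∑ d : {d // d ≠ d₀}, (d.1.cardCentralizer : ℂ)⁻¹ :=
      Finset.sum_congr rfl fun d _ => by rw [hψ1 _ d.2, classVal_one, star_one, mul_one, one_div]
    rw [h3, hψ0, classVal_one, star_one, mul_one] at h1
    have h4 := d₀.cardCentralizer_ne_zero
    have h5 : κ / d₀.cardCentralizer + (1 - (d₀.cardCentralizer : ℂ)⁻¹) = 0 := by
      rw [← h1, ← h2]; ring
    field_simp at h5
    linear_combination h5
  have hz3 : d₀.cardCentralizer = 2 := by
    have h1 : (1 : ℂ) - d₀.cardCentralizer = ((1 - d₀.cardCentralizer : ℝ) : ℂ) := by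
      push_cast; rfl
    rw [hz2, h1, Complex.norm_real, Real.norm_eq_abs] at hκ1
    have h3 : (1 : ℝ) ≤ d₀.cardCentralizer := by exact_mod_cast d₀.cardCentralizer_pos
    rw [abs_of_nonpos (by linarith)] at hκ1
    have : (d₀.cardCentralizer : ℝ) = 2 := by linarith
    exact_mod_cast this
  have hk1 : κ = -1 := by rw [hz2, hz3]; norm_num
  have hvan : ∀ θ : IrrChar H, θ ≠ ψ → θ ≠ τ → classVal θ.1 d₀ = 0 := by
    intro θ h1 h2
    have h3 := IrrChar.sum_classVal_mul_star d₀ d₀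
    rw [if_pos rfl, hz3] at h3
    have h3' : ∑ χ : IrrChar H, ‖classVal χ.1 d₀‖ ^ 2 = 2 := by
      have h4 : ∀ χ : IrrChar H, classVal χ.1 d₀ * star (classVal χ.1 d₀) =
          ((‖classVal χ.1 d₀‖ ^ 2 : ℝ) : ℂ) := fun χ => by
        push_cast; exact Complex.mul_conj' _
      simp only [h4] at h3
      exact_mod_cast h3
    have h5 : ∑ χ ∈ ({θ, ψ, τ} : Finset (IrrChar H)), ‖classVal χ.1 d₀‖ ^ 2 ≤ 2 := by
      rw [← h3']
      exact Finset.sum_le_sum_of_subset_of_nonneg (Finset.subset_univ _) fun _ _ _ => sq_nonneg _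
    rw [Finset.sum_insert (by simp [h1, h2]), Finset.sum_insert (by simp [hψτ]),
      Finset.sum_singleton, hψ0, hk1, classVal_one] at h5
    rw [norm_neg, norm_one] at h5
    have : ‖classVal θ.1 d₀‖ ^ 2 ≤ 0 := by linarith
    exact norm_eq_zero.mp (pow_eq_zero_iff two_ne_zero |>.mp (le_antisymm this (sq_nonneg _)))
  refine ⟨Φ.trans (Equiv.swap ψ τ), σ', fun χ c => ?_⟩
  rw [Equiv.trans_apply]
  have hu := hκ χ
  rw [hk1] at hu
  by_cases h1 : Φ χ = ψ
  · rw [h1, Equiv.swap_apply_left]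
    have h2 : χ = ⟨1, isIrrChar_one⟩ := Φ.injective h1
    rw [h2]; rfl
  by_cases h2 : Φ χ = τ
  · rw [h2, Equiv.swap_apply_right]
    by_cases hc : c = c₀
    · rw [hc, hσ0, hψ0, hk1]
      rw [h2] at hu
      rw [show classVal τ.1 d₀ = 1 from rfl] at hu
      linear_combination hu
    · rw [hσ c hc, hψ1 _ (σ _).2, h χ ⟨c, hc⟩, h2]; rfl
  · rw [Equiv.swap_apply_of_ne_of_ne h1 h2]
    by_cases hc : c = c₀
    · rw [hc, hσ0, hvan _ h1 h2]
      rw [hvan _ h1 h2] at hu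
      linear_combination hu
    · rw [hσ c hc, ← h χ ⟨c, hc⟩]

/-- `χ₀` is a nonprincipal irreducible character of `G` that vanishes off the identity and the
conjugacy class of the nonidentity element `k`. -/
structure IsGagola {G : Type} [Group G] (χ₀ : G → ℂ) (k : G) : Prop where
  irr : IsIrrChar G χ₀
  ne_one : χ₀ ≠ 1
  elt_ne_one : k ≠ 1
  vanish : ∀ g, g ≠ 1 → ¬ IsConj k g → χ₀ g = 0

namespace IsGagola

variable {G : Type} [Group G] {χ₀ : G → ℂ} {k : G}

theorem sum_eq [Fintype G] (hk : k ≠ 1) {F : G → ℂ}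
    (hF : ∀ g, g ≠ 1 → ¬ IsConj k g → F g = 0) (hF' : ∀ g, IsConj k g → F g = F k) :
    ∑ g, F g = F 1 + Nat.card (conjugatesOf k) * F k := by
  classical
  have h1 : ∀ g, F g = (if g = 1 then F 1 else 0) + if g ∈ conjugatesOf k then F k else 0 := by
    intro g
    by_cases h : g = 1
    · have : (1 : G) ∉ conjugatesOf k := fun h' => hk (isConj_one_left.mp h')
      simp [h, this]
    · by_cases h' : IsConj k g
      · rw [if_neg h, if_pos (show g ∈ conjugatesOf k from h'), hF' g h', zero_add]
      · rw [if_neg h, if_neg (show g ∉ conjugatesOf k from h'), hF g h h', zero_add]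
  rw [Finset.sum_congr rfl fun g _ => h1 g, Finset.sum_add_distrib, ← Finset.sum_filter,
    ← Finset.sum_filter, Finset.sum_const, Finset.sum_const, nsmul_eq_mul, nsmul_eq_mul,
    Nat.card_eq_fintype_card, Fintype.card_subtype]
  congr 1
  rw [Finset.filter_eq' Finset.univ (1 : G)]
  simp

theorem star_apply_one (h : IsIrrChar G χ₀) : star (χ₀ 1) = χ₀ 1 := by
  obtain ⟨n, -, hn⟩ := h.one_pos
  rw [hn, star_natCast]

variable [Finite G]

theorem card_pos (k : G) : 0 < Nat.card (conjugatesOf k) := by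
  have : Nonempty (conjugatesOf k) := ⟨⟨k, mem_conjugatesOf_self⟩⟩
  exact Nat.card_pos

theorem card_mul_apply (h : IsGagola χ₀ k) : Nat.card (conjugatesOf k) * χ₀ k = - χ₀ 1 := by
  have := Fintype.ofFinite G
  have h1 := h.irr.sum_mul_star isIrrChar_one
  rw [if_neg h.ne_one] at h1
  simp only [Pi.one_apply, star_one, mul_one] at h1
  rw [sum_eq h.elt_ne_one h.vanish fun g hg => (h.irr.eq_of_isConj hg).symm] at h1
  linear_combination h1

theorem star_apply (h : IsGagola χ₀ k) : star (χ₀ k) = χ₀ k := by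
  have h1 := h.card_mul_apply
  have h2 := congrArg star h1
  rw [star_mul', star_neg, star_apply_one h.irr, star_natCast, ← h1] at h2
  exact mul_left_cancel₀ (by exact_mod_cast (card_pos k).ne') h2

theorem apply_eq_of_ne (h : IsGagola χ₀ k) {χ : G → ℂ} (hχ : IsIrrChar G χ) (hne : χ ≠ χ₀) :
    χ k = χ 1 := by
  have := Fintype.ofFinite G
  have h1 := hχ.sum_mul_star h.irr
  rw [if_neg hne, sum_eq h.elt_ne_one
    (fun g h1 h2 => by rw [h.vanish g h1 h2, star_zero, mul_zero])
    (fun g hg => by rw [h.irr.eq_of_isConj hg, hχ.eq_of_isConj hg]), h.star_apply,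
    star_apply_one h.irr] at h1
  obtain ⟨n, hn, hn'⟩ := h.irr.one_pos
  have h2 : χ₀ 1 ≠ 0 := by rw [hn']; exact_mod_cast hn.ne'
  apply mul_right_cancel₀ h2
  linear_combination -h1 + χ k * h.card_mul_apply

theorem card_eq (h : IsGagola χ₀ k) : ∃ t : ℕ, 0 < t ∧
    χ₀ 1 = Nat.card (conjugatesOf k) * t ∧ χ₀ k = -t ∧
    Nat.card G = (Nat.card (conjugatesOf k) + 1) * Nat.card (conjugatesOf k) * t ^ 2 := by
  have := Fintype.ofFinite G
  obtain ⟨n, hn, hn'⟩ := h.irr.one_pos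
  have hm := card_pos k
  set m := Nat.card (conjugatesOf k)
  have hm' : (m : ℂ) ≠ 0 := by exact_mod_cast hm.ne'
  have h1 : (m : ℂ) * χ₀ k = - n := by rw [h.card_mul_apply, hn']
  have h2 : χ₀ k = algebraMap ℚ ℂ (-n / m) := by
    apply mul_left_cancel₀ hm'
    rw [h1]
    simp only [map_div₀, map_neg, map_natCast]
    field_simp
  have h3 : IsIntegral ℤ (-(n : ℚ) / m) := by
    have h4 := h.irr.isIntegral k
    rw [h2] at h4
    exact (isIntegral_algebraMap_iff (algebraMap ℚ ℂ).injective).mp h4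
  obtain ⟨s, hs⟩ := IsIntegrallyClosed.isIntegral_iff.mp h3
  have hs' : (m : ℤ) * s = - n := by
    have hmq : (m : ℚ) ≠ 0 := by exact_mod_cast hm.ne'
    have : (m : ℚ) * s = - n := by
      rw [show (s : ℚ) = -n / m from hs]
      field_simp
    exact_mod_cast this
  have hs0 : s < 0 := by
    by_contra hc
    have : 0 ≤ (m : ℤ) * s := mul_nonneg (by positivity) (by omega)
    omega
  obtain ⟨t, rfl⟩ : ∃ t : ℕ, s = -t := ⟨s.natAbs, by omega⟩
  have ht : 0 < t := by omega
  have h5 : (m : ℂ) * t = n := by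
    have : (m : ℤ) * t = n := by linarith
    exact_mod_cast this
  have h6 : χ₀ k = -t := by
    apply mul_left_cancel₀ hm'
    rw [h1, ← h5]; ring
  refine ⟨t, ht, by rw [hn', h5], h6, ?_⟩
  have h7 := h.irr.sum_mul_star h.irr
  rw [if_pos rfl, sum_eq h.elt_ne_one
    (fun g h1 h2 => by rw [h.vanish g h1 h2, star_zero, mul_zero])
    (fun g hg => by rw [h.irr.eq_of_isConj hg]), h.star_apply,
    star_apply_one h.irr, h6, hn', ← h5] at h7
  have h8 : (Nat.card G : ℂ) = (m + 1) * m * t ^ 2 := by rw [← h7]; ring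
  exact_mod_cast h8

/-- The intersection of the kernels of the irreducible characters other than `χ₀`. -/
def kernel (χ₀ : G → ℂ) : Subgroup G where
  carrier := {g | ∀ χ, IsIrrChar G χ → χ ≠ χ₀ → χ g = χ 1}
  one_mem' _ _ _ := rfl
  mul_mem' {a b} ha hb χ hχ hne := by
    rw [hχ.mul_of_eq_one (hb χ hχ hne), ha χ hχ hne]
  inv_mem' {a} ha χ hχ hne := by
    rw [hχ.inv_eq_star, ha χ hχ hne, star_apply_one hχ]

theorem mem_kernel_iff (h : IsGagola χ₀ k) {g : G} : g ∈ kernel χ₀ ↔ g = 1 ∨ IsConj k g := by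
  classical
  have := Fintype.ofFinite (IrrChar G)
  constructor
  · intro hg
    by_contra! hc
    have h1 := IrrChar.sum_mul_star g 1
    rw [if_neg (fun h' => hc.1 (isConj_one_left.mp h'))] at h1
    have h2 : ∑ χ : IrrChar G, χ.1 g * star (χ.1 1) =
        ((∑ χ : IrrChar G, if χ.1 = χ₀ then 0 else ‖χ.1 1‖ ^ 2 : ℝ) : ℂ) := by
      push_cast
      refine Finset.sum_congr rfl fun χ _ => ?_
      split_ifs with h3
      · rw [h3, h.vanish g hc.1 hc.2, zero_mul]; rfl
      · rw [hg _ χ.2 h3, Complex.ofReal_pow]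
        exact Complex.mul_conj' _
    rw [h2] at h1
    have h3 := Complex.ofReal_eq_zero.mp h1
    rw [Finset.sum_eq_zero_iff_of_nonneg (fun χ _ => by split_ifs <;> positivity)] at h3
    have h4 := h3 ⟨1, isIrrChar_one⟩ (Finset.mem_univ _)
    rw [if_neg h.ne_one.symm] at h4
    simp at h4
  · rintro (rfl | hg) χ hχ hne
    · rfl
    · rw [← hχ.eq_of_isConj hg, h.apply_eq_of_ne hχ hne]

instance kernel_normal : (kernel χ₀).Normal :=
  ⟨fun n hn g χ hχ hne => by
    rw [← hχ.eq_of_isConj (isConj_iff.mpr ⟨g, rfl⟩ : IsConj n (g * n * g⁻¹)), hn χ hχ hne]⟩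

theorem apply_eq_zero (h : IsGagola χ₀ k) {g : G} (hg : g ∉ kernel χ₀) : χ₀ g = 0 := by
  rw [h.mem_kernel_iff] at hg
  push Not at hg
  exact h.vanish g hg.1 hg.2

theorem isConj_mul (h : IsGagola χ₀ k) {g n : G} (hg : g ∉ kernel χ₀) (hn : n ∈ kernel χ₀) :
    IsConj (g * n) g := by
  apply IrrChar.isConj_of_forall_eq
  intro χ hχ
  by_cases hne : χ = χ₀
  · rw [hne, h.apply_eq_zero hg,
      h.apply_eq_zero (fun h' => hg ((Subgroup.mul_mem_cancel_right _ hn).mp h'))]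
  · exact hχ.mul_of_eq_one (hn χ hχ hne) g

theorem isConj_of_mem (h : IsGagola χ₀ k) {n : G} (hn : n ∈ kernel χ₀) (hn1 : n ≠ 1) :
    IsConj k n :=
  (h.mem_kernel_iff.mp hn).resolve_left hn1

theorem elt_mem (h : IsGagola χ₀ k) : k ∈ kernel χ₀ :=
  h.mem_kernel_iff.mpr (Or.inr (IsConj.refl k))

theorem card_kernel (h : IsGagola χ₀ k) :
    Nat.card (kernel χ₀) = Nat.card (conjugatesOf k) + 1 := by
  have h1 : (kernel χ₀ : Set G) = insert 1 (conjugatesOf k) := by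
    ext g
    exact h.mem_kernel_iff
  have h2 : (1 : G) ∉ conjugatesOf k := fun h' => h.elt_ne_one (isConj_one_left.mp h')
  have h3 := Set.ncard_insert_of_notMem h2 (Set.toFinite _)
  rw [← h1] at h3
  exact h3

theorem orderOf_prime (h : IsGagola χ₀ k) : (orderOf k).Prime := by
  have h1 : orderOf k ≠ 1 := fun h' => h.elt_ne_one (orderOf_eq_one_iff.mp h')
  obtain ⟨p, hp, s, hs⟩ := Nat.exists_prime_and_dvd h1
  have hpos := orderOf_pos k
  have hs0 : s ≠ 0 := by rintro rfl; omega
  have h2 : orderOf (k ^ s) = p := by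
    rw [orderOf_pow_of_dvd hs0 ⟨p, by rw [hs, mul_comm]⟩, hs, Nat.mul_div_cancel _ (by omega)]
  have h3 : k ^ s ≠ 1 := fun h' => by
    rw [h', orderOf_one] at h2
    exact hp.ne_one h2.symm
  have h4 := h.isConj_of_mem (Subgroup.pow_mem _ h.elt_mem s) h3
  have h5 : orderOf (k ^ s) = orderOf k := by
    obtain ⟨c, hc⟩ := isConj_iff.mp h4
    rw [← hc]
    exact orderOf_injective (MulAut.conj c).toMonoidHom (MulAut.conj c).injective k
  rw [← h5, h2]
  exact hp

theorem pow_orderOf (h : IsGagola χ₀ k) {n : G} (hn : n ∈ kernel χ₀) : n ^ orderOf k = 1 := by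
  rcases h.mem_kernel_iff.mp hn with rfl | hn
  · exact one_pow _
  · obtain ⟨c, rfl⟩ := isConj_iff.mp hn
    rw [conj_pow, pow_orderOf_eq_one, mul_one, mul_inv_cancel]

theorem isPGroup_kernel (h : IsGagola χ₀ k) : IsPGroup (orderOf k) (kernel χ₀) := fun n =>
  ⟨1, by rw [pow_one]; exact Subtype.ext (by simpa using h.pow_orderOf n.2)⟩

theorem commute_kernel (h : IsGagola χ₀ k) {a b : G} (ha : a ∈ kernel χ₀) (hb : b ∈ kernel χ₀) :
    a * b = b * a := by
  have := Fact.mk h.orderOf_prime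
  have : Nontrivial (kernel χ₀) :=
    ⟨⟨k, h.elt_mem⟩, 1, fun h' => h.elt_ne_one (congrArg Subtype.val h')⟩
  have := h.isPGroup_kernel.center_nontrivial
  obtain ⟨⟨x, hx⟩, hx1⟩ := exists_ne (1 : Subgroup.center (kernel χ₀))
  have hx1' : (x : G) ≠ 1 := fun h' => hx1 (Subtype.ext (Subtype.ext h'))
  by_cases ha1 : a = 1
  · rw [ha1, one_mul, mul_one]
  obtain ⟨c, hc⟩ := isConj_iff.mp ((h.isConj_of_mem x.2 hx1').symm.trans (h.isConj_of_mem ha ha1))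
  have hb' : c⁻¹ * b * c ∈ kernel χ₀ := by
    simpa using kernel_normal.conj_mem b hb c⁻¹
  have h1 := congrArg Subtype.val (Subgroup.mem_center_iff.mp hx ⟨_, hb'⟩)
  have h2 : (c⁻¹ * b * c) * x.1 = x.1 * (c⁻¹ * b * c) := h1
  calc a * b = c * (x.1 * (c⁻¹ * b * c)) * c⁻¹ := by rw [← hc]; group
    _ = b * a := by rw [← h2, ← hc]; group

/-- Nonidentity elements of the kernel commute only with `p`-elements. -/
theorem eq_of_commute (h : IsGagola χ₀ k) {n y : G} {l : ℕ} (hl : l.Prime) (hy : orderOf y = l)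
    (hn : n ∈ kernel χ₀) (hn1 : n ≠ 1) (hc : Commute y n) : l = orderOf k := by
  by_contra hne
  have hcop : l.Coprime (orderOf k) := (Nat.coprime_primes hl h.orderOf_prime).mpr hne
  have key : ∀ x : G, x ^ l = 1 → x ^ orderOf k = 1 → x = 1 := fun x h1 h2 => by
    have := Nat.dvd_gcd (orderOf_dvd_of_pow_eq_one h1) (orderOf_dvd_of_pow_eq_one h2)
    rw [hcop] at this
    exact orderOf_eq_one_iff.mp (Nat.dvd_one.mp this)
  have hyN : y ∉ kernel χ₀ := fun hyN => by
    have := key y (hy ▸ pow_orderOf_eq_one y) (h.pow_orderOf hyN)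
    rw [this, orderOf_one] at hy
    exact hl.ne_one hy.symm
  have h1 := (h.isConj_mul hyN hn).pow l
  have hyl : y ^ l = 1 := hy ▸ pow_orderOf_eq_one y
  rw [hc.mul_pow, hyl, one_mul] at h1
  exact hn1 (key n (isConj_one_left.mp h1) (h.pow_orderOf hn))

/-- The numerical structure of a group with a Gagola character. -/
theorem exists_parameters (h : IsGagola χ₀ k) : ∃ e b : ℕ, 0 < e ∧
    Nat.card (kernel χ₀) = orderOf k ^ e ∧
    Nat.card G = orderOf k ^ e * ((orderOf k ^ e - 1) * orderOf k ^ (2 * b)) ∧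
    χ₀ 1 = ((orderOf k ^ e - 1) * orderOf k ^ b : ℕ) ∧ χ₀ k = -((orderOf k ^ b : ℕ) : ℂ) := by
  have := Fact.mk h.orderOf_prime
  obtain ⟨e, he⟩ := IsPGroup.iff_card.mp h.isPGroup_kernel
  obtain ⟨t, ht, h1, h2, h3⟩ := h.card_eq
  have hm := card_pos k
  have hcard := h.card_kernel
  rw [he] at hcard
  have hcen := card_conjugatesOf_mul_card_centralizer k
  set m := Nat.card (conjugatesOf k)
  have hcen' : Nat.card (Subgroup.centralizer {k}) = (m + 1) * t ^ 2 := by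
    apply Nat.eq_of_mul_eq_mul_left hm
    rw [hcen, h3]; ring
  have ht2 : t = orderOf k ^ t.primeFactorsList.length := by
    apply Nat.eq_prime_pow_of_unique_prime_dvd ht.ne'
    intro l hl hlt
    have := Fact.mk hl
    obtain ⟨y, hy⟩ := exists_prime_orderOf_dvd_card' (G := Subgroup.centralizer {k}) l (by
      rw [hcen']
      exact dvd_mul_of_dvd_right (dvd_pow hlt two_ne_zero) _)
    refine h.eq_of_commute hl (y := y.1) (by rw [Subgroup.orderOf_coe, hy]) h.elt_mem
      h.elt_ne_one ?_
    exact (Subgroup.mem_centralizer_singleton_iff.mp y.2)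
  set b := t.primeFactorsList.length
  have hm2 : orderOf k ^ e - 1 = m := by omega
  refine ⟨e, b, ?_, he, ?_, ?_, ?_⟩
  · rcases Nat.eq_zero_or_pos e with rfl | he0
    · rw [pow_zero] at hcard; omega
    · exact he0
  · rw [hm2, h3, hcard, pow_mul', ← ht2]; ring
  · rw [hm2, ← ht2, h1]; push_cast; rfl
  · rw [← ht2, h2]

end IsGagola

section
variable {X : Type*} [Group X]

/-- Commuting elements of prime-power order are comparable if `X` has no elementary abelian
subgroup of rank two. -/
theorem mem_zpowers_of_commute_of_le {l : ℕ} (hl : l.Prime)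
    (hE : ∀ a b : X, Commute a b → a ^ l = 1 → b ^ l = 1 → a ≠ 1 → b ∈ Subgroup.zpowers a)
    {a : X} {i : ℕ} (ha : orderOf a = l ^ i) (j : ℕ) : ∀ b : X, Commute a b → b ^ l ^ j = 1 →
      j ≤ i → b ∈ Subgroup.zpowers a := by
  induction j with
  | zero =>
    intro b _ hb _
    rw [pow_zero, pow_one] at hb
    exact hb ▸ Subgroup.one_mem _
  | succ j ih =>
    intro b hab hb hji
    obtain ⟨s, hs⟩ := Subgroup.mem_zpowers_iff.mp
      (ih (b ^ l) (hab.pow_right l) (by rw [← pow_mul, ← pow_succ', hb]) (by omega))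
    have h1 : a ^ (s * (l : ℤ) ^ j) = 1 := by
      rw [zpow_mul, hs, ← zpow_natCast b, ← zpow_mul]
      have : (l : ℤ) * (l : ℤ) ^ j = ((l ^ (j + 1) : ℕ) : ℤ) := by push_cast; ring
      rw [this, zpow_natCast, hb]
    have h2 := orderOf_dvd_iff_zpow_eq_one.mpr h1
    have hl0 : (l : ℤ) ≠ 0 := by exact_mod_cast hl.ne_zero
    have h3 : (l : ℤ) ∣ s := by
      have h4 : (l : ℤ) * (l : ℤ) ^ j ∣ s * (l : ℤ) ^ j := by
        refine dvd_trans ?_ h2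
        rw [ha, ← pow_succ']
        push_cast
        exact pow_dvd_pow _ hji
      exact (mul_dvd_mul_iff_right (pow_ne_zero _ hl0)).mp h4
    obtain ⟨s', rfl⟩ := h3
    have hx : (b * a ^ (-s')) ^ l = 1 := by
      rw [(hab.symm.zpow_right _).mul_pow, ← zpow_natCast (a ^ (-s')), ← zpow_mul, ← hs,
        ← zpow_add]
      rw [show (l : ℤ) * s' + -s' * l = 0 by ring, zpow_zero]
    have ha1 : (a ^ l ^ (i - 1)) ^ l = 1 := by
      rw [← pow_mul, ← pow_succ, Nat.sub_add_cancel (by omega), ← ha, pow_orderOf_eq_one]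
    have ha2 : a ^ l ^ (i - 1) ≠ 1 := by
      intro h
      have := orderOf_dvd_of_pow_eq_one h
      rw [ha] at this
      have := (Nat.pow_dvd_pow_iff_le_right hl.one_lt).mp this
      omega
    have h5 := hE _ _ ((hab.pow_left _).mul_right
      (((Commute.refl a).zpow_right (-s')).pow_left (l ^ (i - 1)))) ha1 hx ha2
    have h6 : b * a ^ (-s') ∈ Subgroup.zpowers a :=
      (Subgroup.zpowers_le.mpr (Subgroup.pow_mem _ (Subgroup.mem_zpowers a) _)) h5
    exact (Subgroup.mul_mem_cancel_right _ (Subgroup.zpow_mem _ (Subgroup.mem_zpowers a) _)).mp h6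

theorem mem_zpowers_or_of_commute {l : ℕ} (hl : l.Prime)
    (hE : ∀ a b : X, Commute a b → a ^ l = 1 → b ^ l = 1 → a ≠ 1 → b ∈ Subgroup.zpowers a)
    {a b : X} {i j : ℕ} (ha : orderOf a = l ^ i) (hb : orderOf b = l ^ j) (hab : Commute a b) :
    b ∈ Subgroup.zpowers a ∨ a ∈ Subgroup.zpowers b := by
  rcases le_total j i with h | h
  · exact Or.inl (mem_zpowers_of_commute_of_le hl hE ha j b hab
      (by rw [← hb, pow_orderOf_eq_one]) h)
  · exact Or.inr (mem_zpowers_of_commute_of_le hl hE hb i a hab.symm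
      (by rw [← ha, pow_orderOf_eq_one]) h)

theorem mul_pow_of_commutator {g v u : X} (h : v * g = g * v * u) (hg : Commute u g)
    (hv : Commute u v) (n : ℕ) : (g * v) ^ n = g ^ n * v ^ n * u ^ (∑ i ∈ Finset.range n, i) := by
  have h1 : ∀ n : ℕ, v ^ n * g = g * v ^ n * u ^ n := by
    intro n
    induction n with
    | zero => simp
    | succ n ih =>
      calc v ^ (n + 1) * g = v ^ n * (v * g) := by rw [pow_succ, mul_assoc]
        _ = (v ^ n * g) * v * u := by rw [h]; simp only [mul_assoc]
        _ = g * v ^ n * (u ^ n * v) * u := by rw [ih]; simp only [mul_assoc]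
        _ = _ := by rw [(hv.pow_left n).eq, pow_succ v, pow_succ u]; simp only [mul_assoc]
  induction n with
  | zero => simp
  | succ n ih =>
    set T := ∑ i ∈ Finset.range n, i
    have h2 : Commute (u ^ T) (g * v) := (hg.mul_right hv).pow_left T
    calc (g * v) ^ (n + 1) = g ^ n * v ^ n * (u ^ T * (g * v)) := by
          rw [pow_succ, ih, mul_assoc]
      _ = g ^ n * (v ^ n * g) * v * u ^ T := by rw [h2.eq]; simp only [mul_assoc]
      _ = g ^ n * g * v ^ n * (u ^ n * v) * u ^ T := by rw [h1]; simp only [mul_assoc]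
      _ = _ := by
        rw [(hv.pow_left n).eq, Finset.sum_range_succ, add_comm T n, pow_add u, pow_succ g,
          pow_succ v]
        simp only [mul_assoc]

end

section
variable {A : Type*} [CommGroup A]

theorem MulAut.prod_pow_apply_eq_one {γ : MulAut A} {l : ℕ} (hγ : γ ^ l = 1)
    (hfix : ∀ x, γ x = x → x = 1) (x : A) : ∏ i ∈ Finset.range l, (γ ^ i) x = 1 := by
  apply hfix
  rw [map_prod]
  have h1 : ∀ i, γ ((γ ^ i) x) = (γ ^ (i + 1)) x := fun i => by rw [pow_succ', MulAut.mul_apply]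
  simp_rw [h1]
  have h2 := Finset.prod_range_succ (fun i => (γ ^ i) x) l
  rw [Finset.prod_range_succ', hγ, pow_zero] at h2
  exact mul_right_cancel h2

theorem MulAut.pow_eq_one_of_commute {α β : MulAut A} {l : ℕ} (hl : 0 < l) (hαβ : Commute α β)
    (hα : α ^ l = 1) (hβ : β ^ l = 1) (h1 : ∀ j x, (α * β ^ j) x = x → x = 1)
    (h2 : ∀ i, 0 < i → i < l → ∀ x, (β ^ i) x = x → x = 1) (x : A) : x ^ l = 1 := by
  have h3 : ∏ j ∈ Finset.range l, ∏ i ∈ Finset.range l, ((α * β ^ j) ^ i) x = 1 := by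
    refine Finset.prod_eq_one fun j _ => MulAut.prod_pow_apply_eq_one ?_ (h1 j) x
    rw [(hαβ.pow_right j).mul_pow, hα, ← pow_mul, mul_comm j l, pow_mul, hβ, one_pow, one_mul]
  rw [Finset.prod_comm, Finset.prod_eq_single_of_mem 0 (Finset.mem_range.mpr hl)] at h3
  · simpa using h3
  · intro i hi hi0
    have h4 : ∀ j, ((α * β ^ j) ^ i) x = (α ^ i) (((β ^ i) ^ j) x) := fun j => by
      rw [(hαβ.pow_right j).mul_pow, ← pow_mul, mul_comm j i, pow_mul, MulAut.mul_apply]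
    simp_rw [h4]
    rw [← map_prod, MulAut.prod_pow_apply_eq_one, map_one]
    · rw [← pow_mul, mul_comm i l, pow_mul, hβ, one_pow]
    · exact h2 i (Nat.pos_of_ne_zero hi0) (Finset.mem_range.mp hi)

end

namespace IsGagola
variable {G : Type} [Group G] [Finite G] {χ₀ : G → ℂ} {k : G}

theorem mem_zpowers_of_pow_eq_one (h : IsGagola χ₀ k) {l : ℕ} (hl : l.Prime)
    (hlk : l ≠ orderOf k) (a b : G) (hab : Commute a b) (ha : a ^ l = 1) (hb : b ^ l = 1)
    (ha1 : a ≠ 1) : b ∈ Subgroup.zpowers a := by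
  have := Fact.mk hl
  by_contra hc
  let instA : CommGroup (kernel χ₀) :=
    { (inferInstance : Group (kernel χ₀)) with
      mul_comm := fun x y => Subtype.ext (h.commute_kernel x.2 y.2) }
  have hfix : ∀ y : G, y ^ l = 1 → y ≠ 1 →
      ∀ x : kernel χ₀, MulAut.conjNormal y x = x → x = 1 := by
    intro y hy hy1 x hx
    by_contra hx1
    refine hlk (h.eq_of_commute hl (orderOf_eq_prime hy hy1) x.2
      (fun h' => hx1 (Subtype.ext h')) ?_)
    have h1 := congrArg Subtype.val hx
    rw [MulAut.conjNormal_apply] at h1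
    exact mul_inv_eq_iff_eq_mul.mp h1
  let φ : G →* MulAut (kernel χ₀) := MulAut.conjNormal
  have key := MulAut.pow_eq_one_of_commute (A := kernel χ₀) (α := φ b) (β := φ a) hl.pos
    (by rw [Commute, SemiconjBy, ← map_mul, ← map_mul, hab.eq]) (by rw [← map_pow, hb, map_one])
    (by rw [← map_pow, ha, map_one])
    (fun j x hx => hfix (b * a ^ j)
      (by rw [(hab.symm.pow_right j).mul_pow, hb, ← pow_mul, mul_comm j l, pow_mul, ha, one_pow,
        one_mul])
      (fun h' => hc (by
        rw [eq_inv_of_mul_eq_one_left h']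
        exact Subgroup.inv_mem _ (Subgroup.pow_mem _ (Subgroup.mem_zpowers a) _))) x
      (by rw [← map_pow, ← map_mul] at hx; exact hx))
    (fun i hi hil x hx => hfix (a ^ i) (by rw [← pow_mul, mul_comm i l, pow_mul, ha, one_pow])
      (fun h' => by
        have h1 := orderOf_dvd_of_pow_eq_one h'
        rw [orderOf_eq_prime ha ha1] at h1
        exact absurd (Nat.le_of_dvd hi h1) (by omega)) x
      (by rw [← map_pow] at hx; exact hx)) ⟨k, h.elt_mem⟩
  have h2 : k ^ l = 1 := congrArg Subtype.val key
  exact hlk ((Nat.prime_dvd_prime_iff_eq h.orderOf_prime hl).mp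
    (orderOf_dvd_of_pow_eq_one h2)).symm

end IsGagola

theorem IsPGroup.exists_mem_center {Q : Type*} [Group Q] [Finite Q] {l : ℕ} [Fact l.Prime]
    (hQ : IsPGroup l Q) (D : Subgroup Q) [D.Normal] (hD : D ≠ ⊥) :
    ∃ d ∈ D, d ≠ 1 ∧ ∀ r, r * d * r⁻¹ = d := by
  have h1 : l ∣ Nat.card D := by
    rcases (hQ.to_subgroup D).card_eq_or_dvd with h | h
    · exact absurd (Subgroup.eq_bot_of_card_eq D h) hD
    · exact h
  have hQ' : IsPGroup l (ConjAct Q) := hQ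
  obtain ⟨d, hd, hne⟩ := hQ'.exists_fixed_point_of_prime_dvd_card_of_fixed_point D h1
    (a := 1) (fun g => smul_one g)
  refine ⟨d, d.2, fun h => hne (Subtype.ext h.symm), fun r => ?_⟩
  have h2 := congrArg Subtype.val (hd (ConjAct.toConjAct r))
  rwa [ConjAct.Subgroup.val_conj_smul, ConjAct.smul_def, ConjAct.ofConjAct_toConjAct] at h2

theorem IsPGroup.exists_card_lt_orderOf_sq {R : Type} [Group R] [Finite R] {l : ℕ} [Fact l.Prime]
    (hR : IsPGroup l R) (h1R : 1 < Nat.card R)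
    (hE : ∀ a b : R, Commute a b → a ^ l = 1 → b ^ l = 1 → a ≠ 1 → b ∈ Subgroup.zpowers a) :
    ∃ a : R, Nat.card R < orderOf a ^ 2 := by
  have hl : l.Prime := Fact.out
  obtain ⟨a, ha, hmax⟩ := Set.exists_max_image {a : R | (Subgroup.zpowers a).Normal} orderOf
    (Set.toFinite _) ⟨1, by
      rw [Set.mem_ofPred_eq, Subgroup.zpowers_one_eq_bot]; exact Subgroup.normal_bot⟩
  rw [Set.mem_ofPred_eq] at ha
  have hC : ∀ x, Commute a x → x ∈ Subgroup.zpowers a := by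
    by_contra! hc
    obtain ⟨x₀, hx₀, hx₀'⟩ := hc
    let C : Subgroup R := Subgroup.centralizer (Subgroup.zpowers a : Set R)
    have hCmem : ∀ x, x ∈ C ↔ Commute a x := by
      intro x
      rw [Subgroup.mem_centralizer_iff]
      constructor
      · intro h
        exact h a (Subgroup.mem_zpowers a)
      · rintro h _ ⟨i, rfl⟩
        exact h.zpow_left i
    have hD : (C.map (QuotientGroup.mk' (Subgroup.zpowers a))).Normal :=
      (inferInstance : C.Normal).map _ (QuotientGroup.mk'_surjective _)
    obtain ⟨d, hdD, hd1, hdc⟩ := (hR.to_quotient (Subgroup.zpowers a)).exists_mem_center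
      (C.map (QuotientGroup.mk' (Subgroup.zpowers a))) (by
        intro h
        rw [Subgroup.map_eq_bot_iff, QuotientGroup.ker_mk'] at h
        exact hx₀' (h ((hCmem x₀).mpr hx₀)))
    obtain ⟨x, hxC, rfl⟩ := hdD
    replace hxC := (hCmem x).mp hxC
    have hxa : x ∉ Subgroup.zpowers a := fun h => hd1 ((QuotientGroup.eq_one_iff x).mpr h)
    obtain ⟨i, hi⟩ := (IsPGroup.iff_orderOf.mp hR) a
    obtain ⟨j, hj⟩ := (IsPGroup.iff_orderOf.mp hR) x
    have hax : a ∈ Subgroup.zpowers x :=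
      (mem_zpowers_or_of_commute hl hE hi hj hxC).resolve_left hxa
    have hle : Subgroup.zpowers a ≤ Subgroup.zpowers x := Subgroup.zpowers_le.mpr hax
    have hconj : ∀ r, r * x * r⁻¹ ∈ Subgroup.zpowers x := by
      intro r
      have h2 := hdc (QuotientGroup.mk' (Subgroup.zpowers a) r)
      rw [← map_inv, ← map_mul, ← map_mul] at h2
      have h3 : x⁻¹ * (r * x * r⁻¹) ∈ Subgroup.zpowers a := QuotientGroup.eq.mp h2.symm
      exact (Subgroup.mul_mem_cancel_left _
        (Subgroup.inv_mem _ (Subgroup.mem_zpowers x))).mp (hle h3)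
    have hnorm : (Subgroup.zpowers x).Normal := by
      refine ⟨?_⟩
      rintro _ ⟨i, rfl⟩ r
      simp only
      rw [← conj_zpow]
      exact Subgroup.zpow_mem _ (hconj r) i
    have h4 := hmax x hnorm
    have h5 : Subgroup.zpowers a = Subgroup.zpowers x :=
      Subgroup.eq_of_le_of_card_ge hle (by rwa [Nat.card_zpowers, Nat.card_zpowers])
    exact hxa (h5 ▸ Subgroup.mem_zpowers x)
  refine ⟨a, ?_⟩
  have hcent : Subgroup.centralizer {a} = Subgroup.zpowers a := by
    ext x
    rw [Subgroup.mem_centralizer_singleton_iff]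
    constructor
    · intro h
      exact hC x h.symm
    · rintro ⟨i, rfl⟩
      exact ((Commute.refl a).zpow_right i).symm
  have h6 := card_conjugatesOf_mul_card_centralizer a
  rw [hcent, Nat.card_zpowers] at h6
  have ha1 : a ≠ 1 := by
    rintro rfl
    have h7 : ∀ x : R, x = 1 := fun x => by
      simpa using hC x (Commute.one_left x)
    have : Subsingleton R := ⟨fun x y => by rw [h7 x, h7 y]⟩
    rw [Nat.card_of_subsingleton 1] at h1R
    exact lt_irrefl _ h1R
  have hlt : Nat.card (conjugatesOf a) < orderOf a := by
    rw [← Nat.card_zpowers]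
    refine Set.ncard_lt_ncard (s := conjugatesOf a) (t := (Subgroup.zpowers a : Set R))
      ⟨?_, fun hs => ?_⟩ (Set.toFinite _)
    · intro y hy
      obtain ⟨r, rfl⟩ := isConj_iff.mp (show IsConj a y from hy)
      exact ha.conj_mem a (Subgroup.mem_zpowers a) r
    · exact ha1 (isConj_one_left.mp (show IsConj a 1 from hs (Subgroup.one_mem _)))
  rw [← h6, sq]
  exact Nat.mul_lt_mul_of_pos_right hlt (orderOf_pos a)

section
variable {X : Type*} [Group X] {l b u : ℕ} {y z g : X}

theorem pow_mul_pow_of_mul_eq (hyz : Commute y z) (hgz : Commute g z) (h : g * y = y * z * g)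
    (m n : ℕ) : g ^ m * y ^ n = y ^ n * z ^ (m * n) * g ^ m := by
  have h1 : ∀ m, g ^ m * y = y * z ^ m * g ^ m := by
    intro m
    induction m with
    | zero => simp
    | succ m ih =>
      calc g ^ (m + 1) * y = g ^ m * (g * y) := by rw [pow_succ, mul_assoc]
        _ = (g ^ m * y) * z * g := by rw [h]; simp only [mul_assoc]
        _ = y * z ^ m * (g ^ m * z) * g := by rw [ih]; simp only [mul_assoc]
        _ = _ := by rw [(hgz.pow_left m).eq, pow_succ z, pow_succ g]; simp only [mul_assoc]
  induction n with
  | zero => simp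
  | succ n ih =>
    calc g ^ m * y ^ (n + 1) = (g ^ m * y ^ n) * y := by rw [pow_succ, mul_assoc]
      _ = y ^ n * z ^ (m * n) * (g ^ m * y) := by rw [ih]; simp only [mul_assoc]
      _ = y ^ n * (z ^ (m * n) * y) * z ^ m * g ^ m := by rw [h1]; simp only [mul_assoc]
      _ = _ := by
        rw [(hyz.symm.pow_left (m * n)).eq, pow_succ y, mul_add, mul_one, pow_add z]
        simp only [mul_assoc]

variable [Finite X]

theorem false_of_mul_eq (hl : l.Prime)
    (hE : ∀ a b : X, Commute a b → a ^ l = 1 → b ^ l = 1 → a ≠ 1 → b ∈ Subgroup.zpowers a)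
    (hb : 1 ≤ b) (hcard : l = 2 → b = 1 → ¬ 8 ∣ Nat.card X) (hy : orderOf y = l ^ (b + 1))
    (hg : orderOf g = l ^ u) (hzy : z ∈ Subgroup.zpowers y) (hzl : z ^ l = 1) (hz1 : z ≠ 1)
    (hgz : Commute g z) (h : g * y = y * z * g) : False := by
  have hcomm : ∀ x ∈ Subgroup.zpowers y, Commute x y := by
    rintro _ ⟨i, rfl⟩
    exact (Commute.refl y).zpow_left i
  have hyz : Commute y z := (hcomm z hzy).symm
  have hgy : ¬ Commute g y := fun hc => hz1 (by
    rw [hc.eq, mul_assoc] at h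
    have h1 := mul_left_cancel h
    exact (mul_eq_right.mp h1.symm))
  have hpow := pow_mul_pow_of_mul_eq hyz hgz h
  have h1 : Commute y (g ^ l) := by
    have := hpow l 1
    rw [pow_one, mul_one, hzl, mul_one] at this
    exact this.symm
  obtain ⟨i, -, hi⟩ := (Nat.dvd_prime_pow hl).mp (hg ▸ orderOf_pow_dvd (x := g) l)
  have hyg : y ∉ Subgroup.zpowers (g ^ l) := by
    rintro ⟨i, hi⟩
    apply hgy
    rw [← hi]
    exact ((Commute.refl g).pow_right l).zpow_right i
  have h2 := (mem_zpowers_or_of_commute hl hE hy hi h1).resolve_right hyg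
  obtain ⟨j, hj⟩ := mem_powers_iff_mem_zpowers.mpr h2
  simp only at hj
  have hlj : l ∣ j := by
    by_contra hc
    have h3 : j.Coprime (orderOf y) := by
      rw [hy]
      exact (((Nat.Prime.coprime_iff_not_dvd hl).mpr hc).pow_left _).symm
    obtain ⟨n, hn⟩ := exists_pow_eq_self_of_coprime h3
    apply hyg
    rw [← hj]
    exact Subgroup.mem_zpowers_iff.mpr ⟨n, by rw [zpow_natCast, hn]⟩
  obtain ⟨k, rfl⟩ := hlj
  have hv : (y ^ k)⁻¹ * g = g * (y ^ k)⁻¹ * z ^ k := by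
    have h3 := hpow 1 k
    rw [pow_one, one_mul] at h3
    have h4 : Commute (y ^ k)⁻¹ (z ^ k) := (hyz.pow_pow k k).inv_left
    rw [inv_mul_eq_iff_eq_mul, mul_assoc, h4.eq, ← mul_assoc, ← mul_assoc,
      eq_mul_inv_iff_mul_eq, h3, mul_assoc, mul_assoc, (hgz.pow_right k).eq]
  have h5 := mul_pow_of_commutator hv (hgz.symm.pow_left k)
    ((hyz.symm.pow_pow k k).inv_right) l
  set T := ∑ i ∈ Finset.range l, i with hT
  rw [inv_pow, ← pow_mul, mul_comm k l, hj, mul_inv_cancel, one_mul] at h5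
  have hTl : T * 2 = l * (l - 1) := Finset.sum_range_id_mul_two l
  have fin : ∀ t ∈ Subgroup.zpowers y, Commute t g → (g * (y ^ k)⁻¹ * t) ^ l = 1 → False := by
    intro t ht htg h6
    have hzt : Commute z t := by
      obtain ⟨i, rfl⟩ := ht
      exact hyz.symm.zpow_right i
    have h7 := hE z _ ((hgz.symm.mul_right (hyz.symm.pow_right k).inv_right).mul_right hzt)
      hzl h6 hz1
    have h8 := Subgroup.zpowers_le.mpr hzy h7
    have h9 : g ∈ Subgroup.zpowers y :=
      (Subgroup.mul_mem_cancel_right _ (Subgroup.inv_mem _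
        (Subgroup.pow_mem _ (Subgroup.mem_zpowers y) k))).mp
        ((Subgroup.mul_mem_cancel_right _ ht).mp h8)
    exact hgy (hcomm g h9)
  rcases hl.eq_two_or_odd' with rfl | hodd
  · have hT1 : T = 1 := by omega
    rw [hT1, pow_one] at h5
    rcases hb.eq_or_lt with rfl | hb2
    · have h8 := hcard rfl rfl
      have := Fact.mk Nat.prime_two
      have hfac : (Nat.card X).factorization 2 = 2 := by
        apply le_antisymm
        · by_contra! hc
          exact h8 ((Nat.Prime.pow_dvd_iff_le_factorization Nat.prime_two
            Nat.card_pos.ne').mpr (show 3 ≤ _ from hc))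
        · refine (Nat.Prime.pow_dvd_iff_le_factorization Nat.prime_two
            Nat.card_pos.ne').mp ?_
          exact hy ▸ orderOf_dvd_natCard y
      let Q : Sylow 2 X := Sylow.ofCard (Subgroup.zpowers y) (by rw [Nat.card_zpowers, hy, hfac])
      have hP : IsPGroup 2 (Subgroup.zpowers g) :=
        IsPGroup.of_card (n := u) (by rw [Nat.card_zpowers, hg])
      have h9 := hP.inf_normalizer_sylow Q
      have h10 : g ∈ Subgroup.zpowers g ⊓ (Subgroup.normalizer (Q : Set X)) := by
        refine ⟨Subgroup.mem_zpowers g, ?_⟩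
        refine Subgroup.mem_normalizer_fintype fun x hx => ?_
        obtain ⟨i, rfl⟩ := Subgroup.mem_zpowers_iff.mp (show x ∈ Subgroup.zpowers y from hx)
        rw [← conj_zpow, h, mul_inv_cancel_right]
        exact Subgroup.zpow_mem _ (Subgroup.mul_mem _ (Subgroup.mem_zpowers y) hzy) i
      rw [h9] at h10
      exact hgy (hcomm g h10.2)
    · obtain ⟨i, hi⟩ := mem_powers_iff_mem_zpowers.mpr hzy
      simp only at hi
      have h6 : 2 ^ (b + 1) ∣ i * 2 := by
        rw [← hy]
        apply orderOf_dvd_of_pow_eq_one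
        rw [pow_mul, hi, hzl]
      rw [pow_succ] at h6
      obtain ⟨i', rfl⟩ := Nat.dvd_of_mul_dvd_mul_right two_pos h6
      obtain ⟨b', rfl⟩ : ∃ b', b = b' + 2 := ⟨b - 2, by omega⟩
      set t := y ^ (2 * (2 ^ b' * i')) with ht
      have ht2 : t ^ 2 = z := by
        rw [ht, ← pow_mul, ← hi]
        congr 1
        ring
      have htg : Commute t g := by
        have h7 := hpow 1 (2 * (2 ^ b' * i'))
        rw [one_mul, pow_mul z, hzl, one_pow, mul_one, pow_one] at h7
        exact h7.symm
      have hty : t ∈ Subgroup.zpowers y := Subgroup.pow_mem _ (Subgroup.mem_zpowers y) _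
      refine fin (t ^ k)⁻¹ (Subgroup.inv_mem _ (Subgroup.pow_mem _ hty k))
        (htg.pow_left k).inv_left ?_
      have h8 : Commute (g * (y ^ k)⁻¹) (t ^ k)⁻¹ :=
        ((htg.symm.mul_left ((hcomm t hty).symm.pow_left k).inv_left).pow_right k).inv_right
      rw [h8.mul_pow, h5, inv_pow, ← pow_mul, mul_comm k 2, pow_mul, ht2, mul_inv_cancel]
  · refine fin 1 (Subgroup.one_mem _) (Commute.one_left g) ?_
    have h6 : l ∣ T := by
      have h7 : l.Coprime 2 := Nat.coprime_two_right.mpr hodd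
      exact h7.dvd_of_dvd_mul_right ⟨l - 1, hTl⟩
    obtain ⟨s, hs⟩ := h6
    rw [mul_one, h5, ← pow_mul, hs, show k * (l * s) = l * (k * s) by ring, pow_mul, hzl, one_pow]

theorem not_isConj_pow {m : ℕ} (hl : l.Prime)
    (hE : ∀ a b : X, Commute a b → a ^ l = 1 → b ^ l = 1 → a ≠ 1 → b ∈ Subgroup.zpowers a)
    (hb : 1 ≤ b) (hcard : l = 2 → b = 1 → ¬ 8 ∣ Nat.card X) (hy : orderOf y = l ^ (b + 1))
    (hm : ¬ l ∣ m) : ¬ IsConj y (y ^ (1 + m * l ^ b)) := by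
  intro hc
  obtain ⟨g, hg⟩ := isConj_iff.mp hc
  set z := y ^ (m * l ^ b) with hz
  rw [pow_add, pow_one, ← hz] at hg
  have hyz : Commute y z := (Commute.refl y).pow_right _
  have hzl : z ^ l = 1 := by
    rw [hz, ← pow_mul, mul_assoc, ← pow_succ, ← hy, mul_comm, pow_mul, pow_orderOf_eq_one, one_pow]
  have hz1 : z ≠ 1 := by
    intro h
    have h1 := orderOf_dvd_of_pow_eq_one h
    rw [hy, pow_succ', Nat.mul_dvd_mul_iff_right (pow_pos hl.pos b)] at h1
    exact hm h1
  have hgz : Commute g z := by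
    have h1 : g * z * g⁻¹ = z := by
      conv_lhs => rw [hz, ← conj_pow, hg, hyz.mul_pow, ← hz]
      obtain ⟨b', rfl⟩ : ∃ b', b = b' + 1 := ⟨b - 1, by omega⟩
      rw [pow_succ, show m * (l ^ b' * l) = l * (m * l ^ b') by ring, pow_mul z, hzl, one_pow,
        mul_one]
    exact mul_inv_eq_iff_eq_mul.mp h1
  have hgy : g * y = y * z * g := mul_inv_eq_iff_eq_mul.mp hg
  obtain ⟨u, w, hw, huw⟩ := Nat.exists_eq_pow_mul_and_not_dvd (orderOf_pos g).ne' l hl.ne_one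
  have hw0 : w ≠ 0 := by rintro rfl; exact hw (dvd_zero l)
  refine false_of_mul_eq (g := g ^ w) (z := z ^ w) (u := u) hl hE hb hcard hy ?_
    (Subgroup.pow_mem _ (Subgroup.pow_mem _ (Subgroup.mem_zpowers y) _) _) ?_ ?_
    (hgz.pow_pow w w) ?_
  · rw [orderOf_pow_of_dvd hw0 ⟨_, by rw [huw, mul_comm]⟩, huw,
      Nat.mul_div_cancel _ (Nat.pos_of_ne_zero hw0)]
  · rw [← pow_mul, mul_comm, pow_mul, hzl, one_pow]
  · intro h
    have h1 := orderOf_dvd_of_pow_eq_one h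
    have := Fact.mk hl
    rw [orderOf_eq_prime hzl hz1] at h1
    exact hw h1
  · simpa using pow_mul_pow_of_mul_eq hyz hgz hgy w 1

end

theorem Finset.sum_range_mul_of_dvd {W l : ℕ} (hW : 0 < W) {f : ℕ → ℂ}
    (hf : ∀ j, ¬ W ∣ j → f j = 0) :
    ∑ j ∈ Finset.range (W * l), f j = ∑ i ∈ Finset.range l, f (W * i) := by
  have h1 : ∑ i ∈ Finset.range l, f (W * i) =
      ∑ j ∈ (Finset.range l).image (fun i => W * i), f j := by
    rw [Finset.sum_image]
    intro i _ j _ hij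
    exact Nat.eq_of_mul_eq_mul_left hW hij
  rw [h1]
  symm
  apply Finset.sum_subset
  · intro j hj
    obtain ⟨i, hi, rfl⟩ := Finset.mem_image.mp hj
    exact Finset.mem_range.mpr (Nat.mul_lt_mul_of_pos_left (Finset.mem_range.mp hi) hW)
  · intro j hj hj'
    apply hf
    rintro ⟨i, rfl⟩
    exact hj' (Finset.mem_image.mpr ⟨i, Finset.mem_range.mpr
      (Nat.lt_of_mul_lt_mul_left (Finset.mem_range.mp hj)), rfl⟩)

theorem IsIrrChar.exists_sum_pow_mul_eq {G : Type} [Group G] [Finite G] {χ : G → ℂ}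
    (hχ : IsIrrChar G χ) {g : G} {n : ℕ} (hn : 0 < n) (hg : g ^ n = 1) {ζ : ℂ}
    (hζ : IsPrimitiveRoot ζ n) (k : ℕ) :
    ∃ c : ℕ, ∑ j ∈ Finset.range n, (ζ ^ k) ^ j * χ (g ^ j) = n * c := by
  obtain ⟨m, hm⟩ := hχ.exists_multiplicities hn (by rw [hg]) hζ
  refine ⟨∑ i ∈ Finset.range n, if n ∣ k + i then m i else 0, ?_⟩
  have h1 : ∀ i, ∑ j ∈ Finset.range n, (ζ ^ (k + i)) ^ j = if n ∣ k + i then (n : ℂ) else 0 := by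
    intro i
    split_ifs with h
    · rw [(hζ.pow_eq_one_iff_dvd _).mpr h]
      simp
    · exact geom_sum_eq_zero_of_pow_eq_one
        (by rw [← pow_mul, _root_.mul_comm, pow_mul, hζ.pow_eq_one, one_pow])
        (fun h' => h ((hζ.pow_eq_one_iff_dvd _).mp h'))
  calc ∑ j ∈ Finset.range n, (ζ ^ k) ^ j * χ (g ^ j)
      = ∑ j ∈ Finset.range n, ∑ i ∈ Finset.range n, (m i : ℂ) * (ζ ^ (k + i)) ^ j := by
        refine Finset.sum_congr rfl fun j _ => ?_
        rw [hm j, Finset.mul_sum]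
        refine Finset.sum_congr rfl fun i _ => ?_
        rw [← pow_mul, ← pow_mul, add_mul, pow_add, _root_.mul_comm i j]
        ring
    _ = ∑ i ∈ Finset.range n, (m i : ℂ) * if n ∣ k + i then (n : ℂ) else 0 := by
        rw [Finset.sum_comm]
        refine Finset.sum_congr rfl fun i _ => ?_
        rw [← Finset.mul_sum, h1]
    _ = _ := by
        rw [Nat.cast_sum, Finset.mul_sum]
        refine Finset.sum_congr rfl fun i _ => ?_
        split_ifs <;> simp [_root_.mul_comm]

namespace IsGagola
variable {G : Type} [Group G] [Finite G] {χ₀ : G → ℂ} {k : G} {e b : ℕ}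

theorem false_of_pow_mem_kernel_iff (h : IsGagola χ₀ k) (he : 0 < e)
    (h1 : χ₀ 1 = ((orderOf k ^ e - 1) * orderOf k ^ b : ℕ))
    (hk : χ₀ k = -((orderOf k ^ b : ℕ) : ℂ)) (u : G)
    (hu : ∀ j, u ^ j ∈ kernel χ₀ ↔ orderOf k ^ (b + 1) ∣ j) : False := by
  set l := orderOf k with hl
  have hlp : l.Prime := h.orderOf_prime
  set W := l ^ (b + 1) with hW
  have hW0 : 0 < W := pow_pos hlp.pos _
  have hn : 0 < W * l := Nat.mul_pos hW0 hlp.pos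
  have huW : u ^ W ∈ kernel χ₀ := (hu W).mpr dvd_rfl
  have hun : u ^ (W * l) = 1 := by rw [pow_mul]; exact h.pow_orderOf huW
  have hζ := Complex.isPrimitiveRoot_exp (W * l) hn.ne'
  set ζ := Complex.exp (2 * Real.pi * Complex.I / ((W * l : ℕ) : ℂ))
  have hsum : ∀ k' : ℕ, ∃ c : ℕ,
      ∑ i ∈ Finset.range l, ((ζ ^ W) ^ k') ^ i * χ₀ ((u ^ W) ^ i) = (W * l : ℕ) * c := by
    intro k'
    obtain ⟨c, hc⟩ := h.irr.exists_sum_pow_mul_eq hn hun hζ k'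
    refine ⟨c, ?_⟩
    rw [← hc, Finset.sum_range_mul_of_dvd hW0]
    · refine Finset.sum_congr rfl fun i _ => ?_
      rw [← pow_mul, ← pow_mul, ← pow_mul, ← pow_mul]
      ring_nf
    · intro j hj
      rw [h.apply_eq_zero (fun h' => hj ((hu j).mp h')), mul_zero]
  obtain ⟨c₀, hc₀⟩ := hsum 0
  obtain ⟨c₁, hc₁⟩ := hsum 1
  have hω : IsPrimitiveRoot (ζ ^ W) l := hζ.pow hn rfl
  have hlb : 0 < l ^ b := pow_pos hlp.pos b
  by_cases hx : u ^ W = 1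
  · simp only [hx, one_pow, pow_zero, one_mul, Finset.sum_const, Finset.card_range,
      nsmul_eq_mul, h1] at hc₀
    have h2 : l * ((l ^ e - 1) * l ^ b) = W * l * c₀ := by exact_mod_cast hc₀
    have h3 : (l ^ e - 1) * (l ^ b * l) = (l * c₀) * (l ^ b * l) := by
      rw [hW, pow_succ] at h2
      linarith
    have h4 := Nat.eq_of_mul_eq_mul_right (Nat.mul_pos hlb hlp.pos) h3
    have h5 : l ∣ l ^ e := dvd_pow_self l he.ne'
    have h6 : 0 < l ^ e := pow_pos hlp.pos e
    have h7 : l ∣ 1 := by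
      have := (Nat.dvd_sub_iff_right (by omega : 1 ≤ l ^ e) h5).mp ⟨c₀, h4⟩
      exact this
    exact hlp.one_lt.ne' (Nat.dvd_one.mp h7)
  · have hval : ∀ ω : ℂ, ∑ i ∈ Finset.range l, ω ^ i * χ₀ ((u ^ W) ^ i) =
        χ₀ 1 + (l ^ b : ℕ) - (l ^ b : ℕ) * ∑ i ∈ Finset.range l, ω ^ i := by
      intro ω
      obtain ⟨l', hl'⟩ : ∃ l', l = l' + 1 := ⟨l - 1, by have := hlp.pos; omega⟩
      rw [hl', Finset.sum_range_succ', Finset.sum_range_succ' (fun i => ω ^ i), ← hl']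
      have h2 : ∀ i ∈ Finset.range l', ω ^ (i + 1) * χ₀ ((u ^ W) ^ (i + 1)) =
          -((l ^ b : ℕ) * ω ^ (i + 1)) := by
        intro i hi
        have h3 : (u ^ W) ^ (i + 1) ≠ 1 := by
          intro h'
          have := orderOf_dvd_of_pow_eq_one h'
          have hf := Fact.mk hlp
          rw [orderOf_eq_prime (h.pow_orderOf huW) hx] at this
          have h8 := Nat.le_of_dvd (by omega) this
          have := Finset.mem_range.mp hi
          omega
        rw [← h.irr.eq_of_isConj (h.isConj_of_mem (Subgroup.pow_mem _ huW _) h3), hk]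
        ring
      rw [Finset.sum_congr rfl h2, Finset.sum_neg_distrib, ← Finset.mul_sum]
      simp only [pow_zero, one_mul]
      ring
    rw [hval] at hc₀ hc₁
    rw [pow_one, hω.geom_sum_eq_zero hlp.one_lt] at hc₁
    simp only [pow_zero, one_pow, Finset.sum_const, Finset.card_range, nsmul_eq_mul,
      mul_one] at hc₀
    have h2 : ((l ^ b : ℕ) : ℂ) * l + ((W * l : ℕ) : ℂ) * c₀ = ((W * l : ℕ) : ℂ) * c₁ := by
      linear_combination hc₁ - hc₀
    have h3 : l ^ b * l + W * l * c₀ = W * l * c₁ := by exact_mod_cast h2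
    have h4 : W * l ∣ l ^ b * l :=
      (Nat.dvd_add_left (dvd_mul_right _ _)).mp (h3 ▸ dvd_mul_right _ _)
    rw [hW, ← pow_succ, ← pow_succ, Nat.pow_dvd_pow_iff_le_right hlp.one_lt] at h4
    omega

theorem pow_mem_kernel (h : IsGagola χ₀ k) (he : 0 < e)
    (hker : Nat.card (kernel χ₀) = orderOf k ^ e)
    (hG : Nat.card G = orderOf k ^ e * ((orderOf k ^ e - 1) * orderOf k ^ (2 * b)))
    (h1 : χ₀ 1 = ((orderOf k ^ e - 1) * orderOf k ^ b : ℕ))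
    (hk : χ₀ k = -((orderOf k ^ b : ℕ) : ℂ)) (g : G) :
    g ^ ((orderOf k ^ e - 1) * orderOf k ^ b) ∈ kernel χ₀ := by
  have hlp : (orderOf k).Prime := h.orderOf_prime
  have hmem : ∀ j, g ^ j ∈ kernel χ₀ ↔ orderOf (g : G ⧸ kernel χ₀) ∣ j := by
    intro j
    rw [orderOf_dvd_iff_pow_eq_one, ← QuotientGroup.mk_pow, QuotientGroup.eq_one_iff]
  have hcard : Nat.card (G ⧸ kernel χ₀) = (orderOf k ^ e - 1) * orderOf k ^ (2 * b) := by
    have h2 := Subgroup.card_eq_card_quotient_mul_card_subgroup (kernel χ₀)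
    rw [hker, hG, mul_comm] at h2
    exact (Nat.eq_of_mul_eq_mul_right (pow_pos hlp.pos e) h2).symm
  set o := orderOf (g : G ⧸ kernel χ₀) with ho
  have ho0 : 0 < o := orderOf_pos _
  have hodvd : o ∣ (orderOf k ^ e - 1) * orderOf k ^ (2 * b) := hcard ▸ orderOf_dvd_natCard _
  obtain ⟨a, w, hw, how⟩ := Nat.exists_eq_pow_mul_and_not_dvd ho0.ne' (orderOf k) hlp.ne_one
  by_cases hab : a ≤ b
  · rw [hmem, how, mul_comm]
    refine mul_dvd_mul ?_ (pow_dvd_pow _ hab)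
    have h2 : w.Coprime (orderOf k ^ (2 * b)) :=
      (((Nat.Prime.coprime_iff_not_dvd hlp).mpr hw).pow_left _).symm
    exact h2.dvd_of_dvd_mul_right ((how ▸ dvd_mul_left w _ : w ∣ o).trans hodvd)
  · exfalso
    obtain ⟨a', rfl⟩ : ∃ a', a = (b + 1) + a' := ⟨a - (b + 1), by omega⟩
    rw [pow_add, mul_assoc] at how
    set v := orderOf k ^ a' * w with hv
    have hv0 : 0 < v := Nat.pos_of_mul_pos_left (how ▸ ho0)
    refine h.false_of_pow_mem_kernel_iff he h1 hk (g ^ v) fun j => ?_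
    rw [← pow_mul, hmem, how, mul_comm, Nat.mul_dvd_mul_iff_left hv0]

end IsGagola

theorem exists_orderOf_eq_pow {X : Type} [Group X] [Finite X] {l c d : ℕ} (hl : l.Prime)
    (hE : ∀ a b : X, Commute a b → a ^ l = 1 → b ^ l = 1 → a ≠ 1 → b ∈ Subgroup.zpowers a)
    (hc : 0 < c) (hd : ¬ l ∣ d) (hX : Nat.card X = d * l ^ (2 * c)) :
    ∃ y : X, orderOf y = l ^ (c + 1) := by
  have := Fact.mk hl
  have hd0 : d ≠ 0 := by rintro rfl; exact hd (dvd_zero l)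
  obtain ⟨R⟩ : Nonempty (Sylow l X) := inferInstance
  have hR : Nat.card R = l ^ (2 * c) := by
    rw [R.card_eq_multiplicity, hX, Nat.factorization_mul hd0 (pow_pos hl.pos _).ne',
      Finsupp.add_apply, Nat.factorization_eq_zero_of_not_dvd hd, zero_add,
      hl.factorization_pow, Finsupp.single_eq_same]
  obtain ⟨a, ha⟩ := R.isPGroup'.exists_card_lt_orderOf_sq
    (by rw [hR]; exact Nat.one_lt_pow (by omega) hl.one_lt) (fun a b hab h1 h2 h3 => by
      have h4 := hE a b (congrArg Subtype.val hab) (by exact_mod_cast congrArg Subtype.val h1)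
        (by exact_mod_cast congrArg Subtype.val h2) (fun h => h3 (Subtype.ext h))
      obtain ⟨i, hi⟩ := Subgroup.mem_zpowers_iff.mp h4
      exact Subgroup.mem_zpowers_iff.mpr ⟨i, Subtype.ext (by exact_mod_cast hi)⟩)
  obtain ⟨i, hi⟩ := (IsPGroup.iff_orderOf.mp R.isPGroup') a
  rw [hR, hi, ← pow_mul, Nat.pow_lt_pow_iff_right hl.one_lt] at ha
  obtain ⟨j, rfl⟩ : ∃ j, i = (c + 1) + j := ⟨i - (c + 1), by omega⟩
  refine ⟨(a : X) ^ l ^ j, ?_⟩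
  rw [orderOf_pow_of_dvd (pow_pos hl.pos _).ne', Subgroup.orderOf_coe, hi, pow_add,
    Nat.mul_div_cancel _ (pow_pos hl.pos _)]
  rw [Subgroup.orderOf_coe, hi, pow_add]
  exact dvd_mul_left _ _

namespace IsGagola
variable {G H : Type} [Group G] [Finite G] [Group H] [Finite H] {χ₀ : G → ℂ} {ψ₀ : H → ℂ}
  {k : G} {k' : H} {e f b c : ℕ}

theorem orderOf_eq_of_pos (hχ : IsGagola χ₀ k) (hψ : IsGagola ψ₀ k')
    (Φ : ∀ χ, IsIrrChar G χ → χ ≠ χ₀ → H → ℂ) (hΦ : ∀ χ h h', IsIrrChar H (Φ χ h h'))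
    (hΦ' : ∀ χ h h', Φ χ h h' ≠ ψ₀) (htable : ∀ g, ∃ g', ∀ χ h h', χ g = Φ χ h h' g')
    (hkerG : Nat.card (kernel χ₀) = orderOf k ^ e)
    (hG : Nat.card G = orderOf k ^ e * ((orderOf k ^ e - 1) * orderOf k ^ (2 * b)))
    (hf : 0 < f) (hkerH : Nat.card (kernel ψ₀) = orderOf k' ^ f)
    (hH : Nat.card H = orderOf k' ^ f * ((orderOf k' ^ f - 1) * orderOf k' ^ (2 * c)))
    (h1 : ψ₀ 1 = ((orderOf k' ^ f - 1) * orderOf k' ^ c : ℕ))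
    (hk : ψ₀ k' = -((orderOf k' ^ c : ℕ) : ℂ))
    (hr : (orderOf k ^ e - 1) * orderOf k ^ (2 * b) =
      (orderOf k' ^ f - 1) * orderOf k' ^ (2 * c)) (hc : 0 < c) : orderOf k = orderOf k' := by
  by_contra hne
  have hp : (orderOf k).Prime := hχ.orderOf_prime
  have hl : (orderOf k').Prime := hψ.orderOf_prime
  have hpowH := hψ.pow_mem_kernel hf hkerH hH h1 hk
  rw [hr] at hG
  set p := orderOf k
  set l := orderOf k'
  set m := l ^ f - 1 with hm
  have hlf : 1 < l ^ f := Nat.one_lt_pow hf.ne' hl.one_lt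
  have hm0 : 0 < m := by omega
  have hlm : l.Coprime m := by
    have h2 : (l ^ f).Coprime m := by
      rw [show l ^ f = m + 1 by omega]
      exact (Nat.coprime_self_add_left.mpr (Nat.coprime_one_left m))
    exact (Nat.coprime_pow_left_iff hf l m).mp h2
  have hlm' : ¬ l ∣ m := (Nat.Prime.coprime_iff_not_dvd hl).mp hlm
  set r := m * l ^ (2 * c) with hrdef
  have hr0 : 0 < r := Nat.mul_pos hm0 (pow_pos hl.pos _)
  have hpowG : ∀ g : G, g ^ r ∈ kernel χ₀ := by
    intro g
    have hcard : Nat.card (G ⧸ kernel χ₀) = r := by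
      have h2 := Subgroup.card_eq_card_quotient_mul_card_subgroup (kernel χ₀)
      rw [hkerG, hG, _root_.mul_comm] at h2
      exact (Nat.eq_of_mul_eq_mul_right (pow_pos hp.pos e) h2).symm
    rw [← QuotientGroup.eq_one_iff, QuotientGroup.mk_pow, ← hcard, pow_card_eq_one']
  have hpowH' : ∀ g : H, g ^ r ∈ kernel ψ₀ := by
    intro g
    rw [hrdef, two_mul c, pow_add, ← mul_assoc, pow_mul]
    exact Subgroup.pow_mem _ (hpowH g) _
  set s := 1 + m * l ^ c with hs
  have hsr : s.Coprime r := by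
    have hsm : ∀ x, x ∣ m * l ^ c → s.Coprime x := by
      rintro x ⟨y, hy⟩
      rw [hs, hy]
      simp
    have hsl : s.Coprime l := hsm l ((dvd_pow_self l hc.ne').mul_left m)
    exact Nat.Coprime.mul_right (hsm m (dvd_mul_right _ _)) (hsl.pow_right _)
  have hconj : ∀ g : G, g ∉ kernel χ₀ → IsConj g (g ^ s) := by
    intro g hg
    have hgs : g ^ s ∉ kernel χ₀ := by
      intro hgs
      have h2 := hpowG g
      rw [← QuotientGroup.eq_one_iff, QuotientGroup.mk_pow] at hgs h2
      have h3 := Nat.dvd_gcd (orderOf_dvd_of_pow_eq_one hgs) (orderOf_dvd_of_pow_eq_one h2)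
      rw [hsr, Nat.dvd_one, orderOf_eq_one_iff, QuotientGroup.eq_one_iff] at h3
      exact hg h3
    refine IrrChar.isConj_of_forall_eq fun χ hχi => ?_
    by_cases h2 : χ = χ₀
    · rw [h2, hχ.apply_eq_zero hg, hχ.apply_eq_zero hgs]
    · obtain ⟨g', hg'⟩ := htable g
      have h3 := hΦ χ hχi h2
      rw [hχi.pow_eq_pow_of_coprime h3 hr0 (hpowG g χ hχi h2)
        (hpowH' g' _ h3 (hΦ' χ hχi h2)) (hg' χ hχi h2) hsr, hg' χ hχi h2, hs, pow_add, pow_one,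
        h3.mul_of_eq_one (hpowH g' _ h3 (hΦ' χ hχi h2))]
  have hE := hχ.mem_zpowers_of_pow_eq_one hl (fun h => hne h.symm)
  have hlp : ¬ l ∣ p ^ e * m := by
    intro h
    rcases hl.dvd_mul.mp h with h | h
    · exact hne ((Nat.prime_dvd_prime_iff_eq hl hp).mp (hl.dvd_of_dvd_pow h)).symm
    · exact hlm' h
  rw [hrdef, ← mul_assoc] at hG
  obtain ⟨y, hy⟩ := exists_orderOf_eq_pow hl hE hc hlp hG
  refine not_isConj_pow (m := m) hl hE hc ?_ hy hlm' (hconj y fun hyN => ?_)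
  · intro hl2 hc1 h8
    rw [hG, hl2, hc1, show 8 = 2 * 2 ^ (2 * 1) by norm_num] at h8
    exact hlp (hl2 ▸ Nat.dvd_of_mul_dvd_mul_right (by norm_num) h8)
  · have h2 := orderOf_dvd_of_pow_eq_one (hχ.pow_orderOf hyN)
    rw [hy] at h2
    exact hne ((Nat.prime_dvd_prime_iff_eq hl hp).mp ((dvd_pow_self l (by omega)).trans h2)).symm

end IsGagola

section
variable {G H : Type} [Group G] [Group H]

theorem IrrChar.classVal_eq_symm {Φ : IrrChar G ≃ IrrChar H} {σ : ConjClasses G ≃ ConjClasses H}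
    {x₀ : IrrChar G}
    (h : ∀ χ, χ ≠ x₀ → ∀ c, classVal χ.1 c = classVal (Φ χ).1 (σ c)) (ψ : IrrChar H)
    (hψ : ψ ≠ Φ x₀) (d : ConjClasses H) :
    classVal ψ.1 d = classVal (Φ.symm ψ).1 (σ.symm d) := by
  rw [h _ (fun h' => hψ (by rw [← h', Φ.apply_symm_apply])), Φ.apply_symm_apply,
    σ.apply_symm_apply]

theorem IrrChar.map_eq_one [Finite H] {Φ : IrrChar G ≃ IrrChar H}
    {σ : ConjClasses G ≃ ConjClasses H}
    {x₀ : IrrChar G}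
    (h : ∀ χ, χ ≠ x₀ → ∀ c, classVal χ.1 c = classVal (Φ χ).1 (σ c)) (h1 : x₀.1 = 1) :
    (Φ x₀).1 = 1 := by
  by_contra hne
  obtain ⟨u, hu⟩ := Φ.surjective ⟨1, isIrrChar_one⟩
  have hux : u ≠ x₀ := by
    rintro rfl
    exact hne (by rw [hu])
  refine hux (Subtype.ext ?_)
  rw [h1]
  funext g
  rw [← u.2.classVal_mk, h u hux, hu]
  rfl

theorem IsIrrChar.classVal_one_ne_zero {χ : G → ℂ} (hχ : IsIrrChar G χ) :
    classVal χ (ConjClasses.mk 1) ≠ 0 := by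
  obtain ⟨n, hn, h1⟩ := hχ.one_pos
  rw [hχ.classVal_mk, h1]
  exact_mod_cast hn.ne'

variable [Finite G]

open Classical in
/-- The relation between the omitted rows obtained by subtracting column orthogonality relations. -/
theorem IrrChar.classVal_mul_star_sub [Finite H] {Φ : IrrChar G ≃ IrrChar H}
    {σ : ConjClasses G ≃ ConjClasses H} {x₀ : IrrChar G}
    (h : ∀ χ, χ ≠ x₀ → ∀ c, classVal χ.1 c = classVal (Φ χ).1 (σ c)) (c d : ConjClasses G) :
    classVal x₀.1 c * star (classVal x₀.1 d) -
      classVal (Φ x₀).1 (σ c) * star (classVal (Φ x₀).1 (σ d)) =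
      if c = d then (d.cardCentralizer : ℂ) - (σ d).cardCentralizer else 0 := by
  have := Fintype.ofFinite (IrrChar G)
  have := Fintype.ofFinite (IrrChar H)
  have h1 := IrrChar.sum_classVal_mul_star c d
  have h2 := IrrChar.sum_classVal_mul_star (σ c) (σ d)
  rw [← Equiv.sum_comp Φ] at h2
  have h3 : ∑ χ : IrrChar G, (classVal χ.1 c * star (classVal χ.1 d) -
      classVal (Φ χ).1 (σ c) * star (classVal (Φ χ).1 (σ d))) =
      classVal x₀.1 c * star (classVal x₀.1 d) -
      classVal (Φ x₀).1 (σ c) * star (classVal (Φ x₀).1 (σ d)) := by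
    refine Finset.sum_eq_single_of_mem x₀ (Finset.mem_univ _) fun χ _ hχ => ?_
    rw [h χ hχ, h χ hχ, sub_self]
  rw [← h3, Finset.sum_sub_distrib, h1, h2]
  by_cases hcd : c = d
  · subst hcd
    simp
  · have : σ c ≠ σ d := fun h' => hcd (σ.injective h')
    simp [hcd, this]

theorem IsIrrChar.exists_classVal_ne_zero {χ : G → ℂ} (hχ : IsIrrChar G χ) (h1 : χ ≠ 1) :
    ∃ c, c ≠ ConjClasses.mk 1 ∧ classVal χ c ≠ 0 := by
  classical
  have := Fintype.ofFinite (ConjClasses G)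
  by_contra! hc
  have h2 := hχ.sum_classVal_mul_star isIrrChar_one
  rw [if_neg h1, Finset.sum_eq_single_of_mem (ConjClasses.mk 1) (Finset.mem_univ _)
    (fun c _ hne => by rw [hc c hne, zero_mul, zero_div]), classVal_one, star_one,
    mul_one] at h2
  rcases div_eq_zero_iff.mp h2 with h2 | h2
  · exact hχ.classVal_one_ne_zero h2
  · exact ConjClasses.cardCentralizer_ne_zero _ (by exact_mod_cast h2)

end

namespace IsGagola
variable {G H : Type} [Group G] [Finite G] [Group H] [Finite H] {χ₀ : G → ℂ} {ψ₀ : H → ℂ}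
  {k : G} {k' : H}

theorem classVal_eq (hχ : IsGagola χ₀ k) (hψ : IsGagola ψ₀ k') {Φ : IrrChar G ≃ IrrChar H}
    {σ : ConjClasses G ≃ ConjClasses H} (hΦ : Φ ⟨χ₀, hχ.irr⟩ = ⟨ψ₀, hψ.irr⟩)
    (hσ : σ (ConjClasses.mk 1) = ConjClasses.mk 1)
    (hσk : σ (ConjClasses.mk k) = ConjClasses.mk k')
    (h : ∀ χ : IrrChar G, χ ≠ ⟨χ₀, hχ.irr⟩ → ∀ c, classVal χ.1 c = classVal (Φ χ).1 (σ c))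
    (χ : IrrChar G) (c : ConjClasses G) : classVal χ.1 c = classVal (Φ χ).1 (σ c) := by
  obtain ⟨e, b, he, hkerG, hG, hχ1, hχk⟩ := hχ.exists_parameters
  obtain ⟨f, c', hf, hkerH, hH, hψ1, hψk⟩ := hψ.exists_parameters
  have hp : (orderOf k).Prime := hχ.orderOf_prime
  have hl : (orderOf k').Prime := hψ.orderOf_prime
  have hr : (orderOf k ^ e - 1) * orderOf k ^ (2 * b) =
      (orderOf k' ^ f - 1) * orderOf k' ^ (2 * c') := by
    have h1 := IrrChar.classVal_mul_star_sub h (ConjClasses.mk 1) (ConjClasses.mk 1)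
    rw [if_pos rfl, hσ, hΦ, hχ.irr.classVal_mk, hψ.irr.classVal_mk, star_apply_one hχ.irr,
      star_apply_one hψ.irr, hχ1, hψ1, ConjClasses.cardCentralizer_one,
      ConjClasses.cardCentralizer_one, hG, hH] at h1
    obtain ⟨x, hx⟩ : ∃ x, orderOf k ^ e = x + 1 :=
      ⟨_, (Nat.sub_add_cancel (Nat.one_le_pow _ _ hp.pos)).symm⟩
    obtain ⟨y, hy⟩ : ∃ y, orderOf k' ^ f = y + 1 :=
      ⟨_, (Nat.sub_add_cancel (Nat.one_le_pow _ _ hl.pos)).symm⟩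
    rw [hx, hy, Nat.add_sub_cancel, Nat.add_sub_cancel] at h1 ⊢
    have h2 : ((x * orderOf k ^ (2 * b) : ℕ) : ℂ) = ((y * orderOf k' ^ (2 * c') : ℕ) : ℂ) := by
      push_cast at h1 ⊢
      rw [_root_.mul_comm 2 b, _root_.mul_comm 2 c', pow_mul, pow_mul] at h1 ⊢
      linear_combination -h1
    exact_mod_cast h2
  have key : orderOf k ^ e - 1 = orderOf k' ^ f - 1 ∧ orderOf k ^ b = orderOf k' ^ c' := by
    have hpl : 0 < b ∨ 0 < c' → orderOf k = orderOf k' := by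
      rintro (hb | hc)
      · have hsymm := IrrChar.classVal_eq_symm h
        rw [hΦ] at hsymm
        refine (hψ.orderOf_eq_of_pos hχ (fun ψ hψi _ => (Φ.symm ⟨ψ, hψi⟩).1)
          (fun ψ hψi _ => (Φ.symm ⟨ψ, hψi⟩).2) (fun ψ hψi hne heq => hne ?_) (fun g => ?_)
          hkerH hH he hkerG hG hχ1 hχk hr.symm hb).symm
        · have h2 : Φ.symm ⟨ψ, hψi⟩ = ⟨χ₀, hχ.irr⟩ := Subtype.ext heq
          rw [Equiv.symm_apply_eq, hΦ] at h2
          exact congrArg Subtype.val h2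
        · obtain ⟨g', hg'⟩ := ConjClasses.mk_surjective (σ.symm (ConjClasses.mk g))
          refine ⟨g', fun ψ hψi hne => ?_⟩
          have h2 := hsymm ⟨ψ, hψi⟩ (fun h' => hne (congrArg Subtype.val h')) (ConjClasses.mk g)
          rwa [← hg', IsIrrChar.classVal_mk hψi, (Φ.symm ⟨ψ, hψi⟩).2.classVal_mk] at h2
      · refine hχ.orderOf_eq_of_pos hψ (fun χ hχi _ => (Φ ⟨χ, hχi⟩).1)
          (fun χ hχi _ => (Φ ⟨χ, hχi⟩).2) (fun χ hχi hne heq => hne ?_) (fun g => ?_)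
          hkerG hG hf hkerH hH hψ1 hψk hr hc
        · have h2 : Φ ⟨χ, hχi⟩ = Φ ⟨χ₀, hχ.irr⟩ := by rw [hΦ]; exact Subtype.ext heq
          exact congrArg Subtype.val (Φ.injective h2)
        · obtain ⟨g', hg'⟩ := ConjClasses.mk_surjective (σ (ConjClasses.mk g))
          refine ⟨g', fun χ hχi hne => ?_⟩
          have h2 := h ⟨χ, hχi⟩ (fun h' => hne (congrArg Subtype.val h')) (ConjClasses.mk g)
          rwa [← hg', IsIrrChar.classVal_mk hχi, (Φ ⟨χ, hχi⟩).2.classVal_mk] at h2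
    by_cases hbc : 0 < b ∨ 0 < c'
    · have hpl' := hpl hbc
      have hle : ∀ {p e b f c : ℕ}, p.Prime → 0 < f →
          (p ^ e - 1) * p ^ (2 * b) = (p ^ f - 1) * p ^ (2 * c) → b ≤ c := by
        intro p e b f c hp hf hr
        have h2 : p.Coprime (p ^ f - 1) := by
          rw [Nat.Prime.coprime_iff_not_dvd hp]
          intro h3
          have h4 := (Nat.dvd_sub_iff_right (Nat.one_le_pow f p hp.pos)
            (dvd_pow_self p hf.ne')).mp h3
          exact hp.one_lt.ne' (Nat.dvd_one.mp h4)
        have h3 : p ^ (2 * b) ∣ p ^ (2 * c) :=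
          (h2.pow_left (2 * b)).dvd_of_dvd_mul_left (hr ▸ dvd_mul_left _ _)
        have := (Nat.pow_dvd_pow_iff_le_right hp.one_lt).mp h3
        omega
      rw [← hpl'] at hr ⊢
      obtain rfl : b = c' := le_antisymm (hle hp hf hr) (hle hp he hr.symm)
      exact ⟨Nat.eq_of_mul_eq_mul_right (pow_pos hp.pos _) hr, rfl⟩
    · obtain ⟨rfl, rfl⟩ : b = 0 ∧ c' = 0 := by omega
      simpa using hr
  by_cases hne : χ = ⟨χ₀, hχ.irr⟩
  · subst hne
    rw [hΦ]
    by_cases hc1 : c = ConjClasses.mk 1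
    · rw [hc1, hσ, hχ.irr.classVal_mk, hψ.irr.classVal_mk, hχ1, hψ1, key.1, key.2]
    by_cases hck : c = ConjClasses.mk k
    · rw [hck, hσk, hχ.irr.classVal_mk, hψ.irr.classVal_mk, hχk, hψk, key.2]
    obtain ⟨g, rfl⟩ := ConjClasses.mk_surjective c
    obtain ⟨g', hg'⟩ := ConjClasses.mk_surjective (σ (ConjClasses.mk g))
    rw [← hg', hχ.irr.classVal_mk, hψ.irr.classVal_mk, hχ.vanish, hψ.vanish]
    · rintro rfl
      exact hc1 (σ.injective (by rw [hσ, hg']))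
    · intro hcon
      exact hck (σ.injective (by rw [hσk, ← hg', ConjClasses.mk_eq_mk_iff_isConj.mpr hcon]))
    · rintro rfl
      exact hc1 rfl
    · intro hcon
      exact hck (ConjClasses.mk_eq_mk_iff_isConj.mpr hcon).symm
  · exact h χ hne c

end IsGagola

section
variable {G H : Type} [Group G] [Group H]

theorem IsIrrChar.classVal_one_eq_of_norm_eq {χ : G → ℂ} {ψ : H → ℂ} (hχ : IsIrrChar G χ)
    (hψ : IsIrrChar H ψ)
    (h : ‖classVal χ (ConjClasses.mk 1)‖ = ‖classVal ψ (ConjClasses.mk 1)‖) :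
    classVal χ (ConjClasses.mk 1) = classVal ψ (ConjClasses.mk 1) := by
  obtain ⟨m, -, hm⟩ := hχ.one_pos
  obtain ⟨n, -, hn⟩ := hψ.one_pos
  rw [hχ.classVal_mk, hψ.classVal_mk, hm, hn, Complex.norm_natCast, Complex.norm_natCast] at h
  rw [hχ.classVal_mk, hψ.classVal_mk, hm, hn]
  exact_mod_cast h

variable [Finite G] [Finite H]

theorem ConjClasses.cardCentralizer_le (c : ConjClasses G) : c.cardCentralizer ≤ Nat.card G :=
  Subgroup.card_le_card_group _

theorem IrrChar.sum_norm_sq [Fintype (IrrChar G)] (c : ConjClasses G) :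
    ∑ χ : IrrChar G, ‖classVal χ.1 c‖ ^ 2 = c.cardCentralizer := by
  have h1 := IrrChar.sum_classVal_mul_star c c
  rw [if_pos rfl] at h1
  have h2 : ∀ a : ℂ, a * star a = ((‖a‖ ^ 2 : ℝ) : ℂ) := fun a => by
    rw [← starRingEnd_apply, Complex.mul_conj, Complex.normSq_eq_norm_sq]
  simp_rw [h2] at h1
  exact_mod_cast h1

theorem IsIrrChar.norm_classVal_le {χ : G → ℂ} (hχ : IsIrrChar G χ) (c : ConjClasses G) :
    ‖classVal χ c‖ ≤ ‖classVal χ (ConjClasses.mk 1)‖ := by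
  rw [hχ.classVal_mk]
  exact hχ.norm_le _

theorem IsIrrChar.sum_norm_sq_le_one {χ : G → ℂ} (hχ : IsIrrChar G χ)
    (S : Finset (ConjClasses G)) : ∑ c ∈ S, ‖classVal χ c‖ ^ 2 / c.cardCentralizer ≤ 1 := by
  have := Fintype.ofFinite (ConjClasses G)
  have h1 := hχ.sum_classVal_mul_star hχ
  rw [if_pos rfl] at h1
  have h2 : ∀ a : ℂ, a * star a = ((‖a‖ ^ 2 : ℝ) : ℂ) := fun a => by
    rw [← starRingEnd_apply, Complex.mul_conj, Complex.normSq_eq_norm_sq]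
  simp_rw [h2] at h1
  have h3 : ∑ c, ‖classVal χ c‖ ^ 2 / c.cardCentralizer = 1 := by exact_mod_cast h1
  rw [← h3]
  exact Finset.sum_le_sum_of_subset_of_nonneg (Finset.subset_univ S)
    fun c _ _ => div_nonneg (sq_nonneg _) (Nat.cast_nonneg _)

/-- If `ψ₀` does not vanish on a class `T`, then no class `D` distinct from `1` and `T` with full
centralizer lies in the kernel of all irreducible characters other than `ψ₀`. -/
theorem IrrChar.false_of_forall_norm_eq {y₀ : IrrChar H} {D T : ConjClasses H}
    (hD : D ≠ ConjClasses.mk 1) (hT : T ≠ ConjClasses.mk 1) (hTD : T ≠ D)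
    (hT0 : classVal y₀.1 T ≠ 0) (hDcard : D.cardCentralizer = Nat.card H)
    (h : ∀ ψ : IrrChar H, ψ ≠ y₀ → ‖classVal ψ.1 D‖ = ‖classVal ψ.1 (ConjClasses.mk 1)‖ →
      classVal ψ.1 D = classVal ψ.1 (ConjClasses.mk 1)) : False := by
  classical
  have := Fintype.ofFinite (IrrChar H)
  have h1 : ∀ ψ : IrrChar H, ‖classVal ψ.1 D‖ = ‖classVal ψ.1 (ConjClasses.mk 1)‖ := by
    have h2 : ∑ ψ : IrrChar H, ‖classVal ψ.1 D‖ ^ 2 =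
        ∑ ψ : IrrChar H, ‖classVal ψ.1 (ConjClasses.mk 1)‖ ^ 2 := by
      rw [IrrChar.sum_norm_sq, IrrChar.sum_norm_sq, hDcard, ConjClasses.cardCentralizer_one]
    have h3 := (Finset.sum_eq_sum_iff_of_le fun (ψ : IrrChar H) _ =>
      pow_le_pow_left₀ (norm_nonneg _) (ψ.2.norm_classVal_le D) 2).mp h2
    intro ψ
    exact (pow_left_inj₀ (norm_nonneg _) (norm_nonneg _) two_ne_zero).mp
      (h3 ψ (Finset.mem_univ _))
  have h2 := IrrChar.sum_classVal_mul_star D (ConjClasses.mk 1)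
  rw [if_neg hD] at h2
  have h3 := IrrChar.sum_classVal_mul_star (ConjClasses.mk (1 : H)) (ConjClasses.mk 1)
  rw [if_pos rfl, ConjClasses.cardCentralizer_one, ← sub_zero (∑ χ : IrrChar H, _), ← h2,
    ← Finset.sum_sub_distrib, Finset.sum_eq_single_of_mem y₀ (Finset.mem_univ _)
    (fun ψ _ hψ => by rw [h ψ hψ (h1 ψ), sub_self]), ← sub_mul] at h3
  set n := ‖classVal y₀.1 (ConjClasses.mk 1)‖ with hn
  have h4 : (Nat.card H : ℝ) ≤ 2 * n ^ 2 := by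
    have h5 := congrArg norm h3
    rw [norm_mul, norm_star, Complex.norm_natCast, ← hn] at h5
    have h6 := norm_sub_le (classVal y₀.1 (ConjClasses.mk 1)) (classVal y₀.1 D)
    rw [h1, ← hn] at h6
    rw [← h5]
    nlinarith [norm_nonneg (classVal y₀.1 (ConjClasses.mk 1))]
  have hH : (0 : ℝ) < Nat.card H := by exact_mod_cast Nat.card_pos
  have h7 := y₀.2.sum_norm_sq_le_one {ConjClasses.mk 1, D, T}
  rw [Finset.sum_insert (by simp [hD.symm, hT.symm]), Finset.sum_insert (by simp [hTD.symm]),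
    Finset.sum_singleton, h1, hDcard, ConjClasses.cardCentralizer_one, ← hn] at h7
  have h8 : 0 < ‖classVal y₀.1 T‖ ^ 2 / T.cardCentralizer :=
    div_pos (by positivity) (by exact_mod_cast T.cardCentralizer_pos)
  have h9 : 1 / 2 ≤ n ^ 2 / Nat.card H := by
    rw [le_div_iff₀ hH]
    linarith
  linarith

theorem IrrChar.classVal_eq_of_ne_zero {Φ : IrrChar G ≃ IrrChar H}
    {σ : ConjClasses G ≃ ConjClasses H} {x₀ : IrrChar G}
    (h : ∀ χ, χ ≠ x₀ → ∀ c, classVal χ.1 c = classVal (Φ χ).1 (σ c)) {c d : ConjClasses G}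
    (hc : c ≠ ConjClasses.mk 1) (hd : d ≠ ConjClasses.mk 1) (hcd : c ≠ d)
    (hc0 : classVal x₀.1 c ≠ 0) (hd0 : classVal x₀.1 d ≠ 0) (x : ConjClasses G) :
    classVal x₀.1 x = classVal (Φ x₀).1 (σ x) := by
  classical
  set e : ConjClasses G := ConjClasses.mk 1 with he
  have hstar : ∀ a : ℂ, a * star a = ((‖a‖ ^ 2 : ℝ) : ℂ) := fun a => by
    rw [← starRingEnd_apply, Complex.mul_conj, Complex.normSq_eq_norm_sq]
  have hrel : ∀ x y, x ≠ y → classVal x₀.1 x * star (classVal x₀.1 y) =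
      classVal (Φ x₀).1 (σ x) * star (classVal (Φ x₀).1 (σ y)) := by
    intro x y hxy
    have := IrrChar.classVal_mul_star_sub h x y
    rw [if_neg hxy] at this
    exact sub_eq_zero.mp this
  have he0 : classVal x₀.1 e ≠ 0 := x₀.2.classVal_one_ne_zero
  have hnrel : ∀ x y, x ≠ y → ‖classVal x₀.1 x‖ * ‖classVal x₀.1 y‖ =
      ‖classVal (Φ x₀).1 (σ x)‖ * ‖classVal (Φ x₀).1 (σ y)‖ := by
    intro x y hxy
    have := congrArg norm (hrel x y hxy)
    rwa [norm_mul, norm_mul, norm_star, norm_star] at this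
  have hne : ‖classVal x₀.1 e‖ = ‖classVal (Φ x₀).1 (σ e)‖ := by
    have h1 := hnrel e c hc.symm
    have h2 := hnrel e d hd.symm
    have h3 := hnrel c d hcd
    have h4 : 0 < ‖classVal x₀.1 c‖ * ‖classVal x₀.1 d‖ :=
      mul_pos (norm_pos_iff.mpr hc0) (norm_pos_iff.mpr hd0)
    refine (pow_left_inj₀ (norm_nonneg _) (norm_nonneg _) two_ne_zero).mp
      (mul_right_cancel₀ h4.ne' ?_)
    conv_rhs => rw [h3]
    linear_combination ‖classVal x₀.1 e‖ * ‖classVal x₀.1 d‖ * h1 +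
      ‖classVal (Φ x₀).1 (σ e)‖ * ‖classVal (Φ x₀).1 (σ c)‖ * h2
  have hmul : ∀ x, classVal (Φ x₀).1 (σ x) * classVal x₀.1 e =
      classVal x₀.1 x * classVal (Φ x₀).1 (σ e) := by
    intro x
    by_cases hx : x = e
    · rw [hx, mul_comm]
    · have h1 : star (classVal x₀.1 e) ≠ 0 := by rwa [Ne, star_eq_zero]
      apply mul_right_cancel₀ h1
      have h2 := hstar (classVal x₀.1 e)
      rw [hne, ← hstar] at h2
      linear_combination classVal (Φ x₀).1 (σ x) * h2 - classVal (Φ x₀).1 (σ e) * hrel x e hx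
  have hnorm : ∀ x, ‖classVal x₀.1 x‖ = ‖classVal (Φ x₀).1 (σ x)‖ := by
    intro x
    have h1 := congrArg norm (hmul x)
    rw [norm_mul, norm_mul, ← hne] at h1
    exact (mul_right_cancel₀ (norm_pos_iff.mpr he0).ne' h1).symm
  have hz : ∀ x, x.cardCentralizer = (σ x).cardCentralizer := by
    intro x
    have h1 := IrrChar.classVal_mul_star_sub h x x
    rw [if_pos rfl, hstar, hstar, hnorm, sub_self] at h1
    exact_mod_cast (sub_eq_zero.mp h1.symm)
  have hcard : Nat.card G = Nat.card H := by
    apply le_antisymm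
    · rw [← ConjClasses.cardCentralizer_one, hz]
      exact ConjClasses.cardCentralizer_le _
    · rw [← ConjClasses.cardCentralizer_one, ← σ.apply_symm_apply (ConjClasses.mk 1), ← hz]
      exact ConjClasses.cardCentralizer_le _
  by_cases hσ : σ e = ConjClasses.mk 1
  · have h1 : classVal x₀.1 e = classVal (Φ x₀).1 (σ e) := by
      rw [hσ] at hne ⊢
      exact x₀.2.classVal_one_eq_of_norm_eq (Φ x₀).2 hne
    have h2 := hmul x
    rw [← h1] at h2
    exact (mul_right_cancel₀ he0 h2).symm
  · exfalso
    obtain ⟨t, hte, ht1, ht0⟩ : ∃ t, t ≠ e ∧ σ t ≠ ConjClasses.mk 1 ∧ classVal x₀.1 t ≠ 0 := by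
      by_cases h1 : σ c = ConjClasses.mk 1
      · exact ⟨d, hd, fun h2 => hcd (σ.injective (h1.trans h2.symm)), hd0⟩
      · exact ⟨c, hc, h1, hc0⟩
    refine IrrChar.false_of_forall_norm_eq (y₀ := Φ x₀) hσ ht1
      (fun h' => hte (σ.injective h')) ?_ (by rw [← hz, he, ConjClasses.cardCentralizer_one, hcard])
      fun ψ hψ hψn => ?_
    · rw [← norm_ne_zero_iff, ← hnorm]
      exact norm_ne_zero_iff.mpr ht0
    · have h1 := IrrChar.classVal_eq_symm h ψ hψ (σ e)
      rw [σ.symm_apply_apply] at h1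
      rw [h1] at hψn ⊢
      exact (Φ.symm ψ).2.classVal_one_eq_of_norm_eq ψ.2 hψn

theorem IrrChar.exists_table_equiv_of_support {Φ : IrrChar G ≃ IrrChar H}
    {σ : ConjClasses G ≃ ConjClasses H} {x₀ : IrrChar G}
    (h : ∀ χ, χ ≠ x₀ → ∀ c, classVal χ.1 c = classVal (Φ χ).1 (σ c)) (hx₀ : x₀.1 ≠ 1)
    (hy₀ : (Φ x₀).1 ≠ 1) {c : ConjClasses G} (hc : c ≠ ConjClasses.mk 1)
    (hc0 : classVal x₀.1 c ≠ 0)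
    (hsupp : ∀ x, x ≠ ConjClasses.mk 1 → x ≠ c → classVal x₀.1 x = 0) :
    ∃ σ' : ConjClasses G ≃ ConjClasses H,
      ∀ (χ : IrrChar G) x, classVal χ.1 x = classVal (Φ χ).1 (σ' x) := by
  classical
  set e : ConjClasses G := ConjClasses.mk 1 with he
  have he0 : classVal x₀.1 e ≠ 0 := x₀.2.classVal_one_ne_zero
  have hrel : ∀ x y, x ≠ y → classVal x₀.1 x * star (classVal x₀.1 y) =
      classVal (Φ x₀).1 (σ x) * star (classVal (Φ x₀).1 (σ y)) := by
    intro x y hxy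
    have := IrrChar.classVal_mul_star_sub h x y
    rw [if_neg hxy] at this
    exact sub_eq_zero.mp this
  have hw : classVal (Φ x₀).1 (σ e) ≠ 0 := by
    intro h0
    have h1 := hrel e c hc.symm
    rw [h0, zero_mul] at h1
    exact mul_ne_zero he0 (by rwa [Ne, star_eq_zero]) h1
  have hsupp' : ∀ x, x ≠ e → x ≠ c → classVal (Φ x₀).1 (σ x) = 0 := by
    intro x hxe hxc
    have h1 := hrel x e hxe
    rw [hsupp x hxe hxc, zero_mul, eq_comm, mul_eq_zero, star_eq_zero] at h1
    exact h1.resolve_right hw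
  have hone : σ e = ConjClasses.mk 1 ∨ σ c = ConjClasses.mk 1 := by
    by_contra! h1
    refine (Φ x₀).2.classVal_one_ne_zero ?_
    rw [← σ.apply_symm_apply (ConjClasses.mk 1)]
    refine hsupp' _ (fun h2 => h1.1 ?_) (fun h2 => h1.2 ?_) <;>
      rw [← h2, σ.apply_symm_apply]
  set σ' : ConjClasses G ≃ ConjClasses H := σ.trans (Equiv.swap (σ e) (ConjClasses.mk 1)) with hσ'
  have hσ'e : σ' e = ConjClasses.mk 1 := by simp [hσ']
  have hσ'x : ∀ x, x ≠ e → x ≠ c → σ' x = σ x := by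
    intro x hxe hxc
    rw [hσ', Equiv.trans_apply, Equiv.swap_apply_of_ne_of_ne (fun h1 => hxe (σ.injective h1))]
    intro h1
    rcases hone with h2 | h2
    · exact hxe (σ.injective (h1.trans h2.symm))
    · exact hxc (σ.injective (h1.trans h2.symm))
  obtain ⟨k, hk⟩ := ConjClasses.mk_surjective c
  obtain ⟨k', hk'⟩ := ConjClasses.mk_surjective (σ' c)
  have hG : IsGagola x₀.1 k := by
    refine ⟨x₀.2, hx₀, ?_, fun g hg hkg => ?_⟩
    · rintro rfl
      exact hc hk.symm
    · rw [← x₀.2.classVal_mk]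
      refine hsupp _ (fun h1 => hg ?_) (fun h1 => hkg ?_)
      · exact isConj_one_left.mp (ConjClasses.mk_eq_mk_iff_isConj.mp h1)
      · exact ConjClasses.mk_eq_mk_iff_isConj.mp (hk.trans h1.symm)
  have hH : IsGagola (Φ x₀).1 k' := by
    refine ⟨(Φ x₀).2, hy₀, ?_, fun g hg hkg => ?_⟩
    · rintro rfl
      exact hc (σ'.injective (by rw [hσ'e, hk']))
    · rw [← (Φ x₀).2.classVal_mk]
      obtain ⟨x, hx⟩ := σ'.surjective (ConjClasses.mk g)
      have hxe : x ≠ e := by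
        rintro rfl
        rw [hσ'e] at hx
        exact hg (isConj_one_left.mp (ConjClasses.mk_eq_mk_iff_isConj.mp hx.symm))
      have hxc : x ≠ c := by
        rintro rfl
        exact hkg (ConjClasses.mk_eq_mk_iff_isConj.mp (hk'.trans hx))
      rw [← hx, hσ'x x hxe hxc, hsupp' x hxe hxc]
  refine ⟨σ', hG.classVal_eq hH rfl hσ'e (by rw [hk, hk']) fun χ hχ x => ?_⟩
  have hχ' : (Φ χ).1 ≠ (Φ x₀).1 := fun h1 => hχ (Φ.injective (Subtype.ext h1))
  have hval : classVal (Φ χ).1 (σ' c) = classVal (Φ χ).1 (σ' e) := by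
    rw [← hk', hσ'e, (Φ χ).2.classVal_mk, (Φ χ).2.classVal_mk, hH.apply_eq_of_ne (Φ χ).2 hχ']
  rw [h χ hχ]
  rcases hone with h1 | h1
  · rw [hσ', h1, Equiv.swap_self]
    rfl
  · have hσ'c : σ' c = σ e := by simp [hσ', h1]
    by_cases hxe : x = e
    · rw [hxe, ← hval, hσ'c]
    by_cases hxc : x = c
    · rw [hxc, hval, hσ'e, h1]
    · rw [hσ'x x hxe hxc]

theorem IrrChar.exists_table_equiv {Φ : IrrChar G ≃ IrrChar H}
    {σ : ConjClasses G ≃ ConjClasses H} {x₀ : IrrChar G}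
    (h : ∀ χ, χ ≠ x₀ → ∀ c, classVal χ.1 c = classVal (Φ χ).1 (σ c)) :
    ∃ σ' : ConjClasses G ≃ ConjClasses H,
      ∀ (χ : IrrChar G) c, classVal χ.1 c = classVal (Φ χ).1 (σ' c) := by
  have hfull : (∀ c, classVal x₀.1 c = classVal (Φ x₀).1 (σ c)) →
      ∃ σ' : ConjClasses G ≃ ConjClasses H,
        ∀ (χ : IrrChar G) c, classVal χ.1 c = classVal (Φ χ).1 (σ' c) := fun h0 =>
    ⟨σ, fun χ c => (eq_or_ne χ x₀).elim (fun hχ => hχ ▸ h0 c) fun hχ => h χ hχ c⟩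
  by_cases hx₀ : x₀.1 = 1
  · exact hfull fun c => by rw [hx₀, IrrChar.map_eq_one h hx₀]; rfl
  by_cases hy₀ : (Φ x₀).1 = 1
  · have h1 := IrrChar.map_eq_one (IrrChar.classVal_eq_symm h) hy₀
    rw [Φ.symm_apply_apply] at h1
    exact absurd h1 hx₀
  obtain ⟨c, hc, hc0⟩ := x₀.2.exists_classVal_ne_zero hx₀
  by_cases hd : ∃ d, d ≠ ConjClasses.mk 1 ∧ d ≠ c ∧ classVal x₀.1 d ≠ 0
  · obtain ⟨d, hd, hdc, hd0⟩ := hd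
    exact hfull (IrrChar.classVal_eq_of_ne_zero h hc hd hdc.symm hc0 hd0)
  · push Not at hd
    exact IrrChar.exists_table_equiv_of_support h hx₀ hy₀ hc hc0 hd

theorem exists_table_equiv_of_agree_off_row {χ₀ : G → ℂ} {ψ₀ : H → ℂ} (hχ₀ : IsIrrChar G χ₀)
    (hψ₀ : IsIrrChar H ψ₀)
    (Φ : {χ : G → ℂ // IsIrrChar G χ ∧ χ ≠ χ₀} ≃ {ψ : H → ℂ // IsIrrChar H ψ ∧ ψ ≠ ψ₀})
    (σ : ConjClasses G ≃ ConjClasses H)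
    (h : ∀ χ c, classVal χ.1 c = classVal (Φ χ).1 (σ c)) :
    ∃ (Φ' : IrrChar G ≃ IrrChar H) (σ' : ConjClasses G ≃ ConjClasses H),
      ∀ χ c, classVal χ.1 c = classVal (Φ' χ).1 (σ' c) := by
  let toPair : ∀ {K : Type} [Group K] {θ : K → ℂ} (hθ : IsIrrChar K θ),
      {χ : IrrChar K // χ ≠ ⟨θ, hθ⟩} ≃ {χ : K → ℂ // IsIrrChar K χ ∧ χ ≠ θ} := fun hθ =>
    { toFun := fun χ => ⟨χ.1.1, χ.1.2, fun h => χ.2 (Subtype.ext h)⟩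
      invFun := fun χ => ⟨⟨χ.1, χ.2.1⟩, fun h => χ.2.2 (congrArg Subtype.val h)⟩
      left_inv := fun _ => rfl
      right_inv := fun _ => rfl }
  obtain ⟨Φ', -, hΦ'⟩ := Equiv.exists_extend_subtype_ne
    (((toPair hχ₀).trans Φ).trans (toPair hψ₀).symm)
  refine ⟨Φ', IrrChar.exists_table_equiv (σ := σ) (x₀ := ⟨χ₀, hχ₀⟩) fun χ hχ c => ?_⟩
  rw [hΦ' χ hχ]
  exact h ⟨χ.1, χ.2, fun h => hχ (Subtype.ext h)⟩ c

end

/-- There are no finite groups whose character tables differ by only one row or only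
one column: if the tables of `G` and `H` agree off one column (case (a)) or off one row
(case (b)), then the full character tables are identical. -/
theorem character_tables_differ_by_one_row_or_column (G H : Type)
    [Group G] [Finite G] [Group H] [Finite H]
    (hcase :
      (∃ (Φ : {χ : G → ℂ // IsIrrChar G χ} ≃ {ψ : H → ℂ // IsIrrChar H ψ})
          (c₀ : ConjClasses G) (d₀ : ConjClasses H)
          (σ : {c : ConjClasses G // c ≠ c₀} ≃ {d : ConjClasses H // d ≠ d₀}),
          ∀ (χ : {χ : G → ℂ // IsIrrChar G χ}) (c : {c : ConjClasses G // c ≠ c₀}),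
            classVal χ.1 c.1 = classVal (Φ χ).1 (σ c).1) ∨
      (∃ (χ₀ : G → ℂ) (ψ₀ : H → ℂ), IsIrrChar G χ₀ ∧ IsIrrChar H ψ₀ ∧
          ∃ (Φ : {χ : G → ℂ // IsIrrChar G χ ∧ χ ≠ χ₀} ≃
                 {ψ : H → ℂ // IsIrrChar H ψ ∧ ψ ≠ ψ₀})
            (σ : ConjClasses G ≃ ConjClasses H),
            ∀ (χ : {χ : G → ℂ // IsIrrChar G χ ∧ χ ≠ χ₀}) (c : ConjClasses G),
              classVal χ.1 c = classVal (Φ χ).1 (σ c))) :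
    ∃ (Φ' : {χ : G → ℂ // IsIrrChar G χ} ≃ {ψ : H → ℂ // IsIrrChar H ψ})
      (σ' : ConjClasses G ≃ ConjClasses H),
      ∀ (χ : {χ : G → ℂ // IsIrrChar G χ}) (c : ConjClasses G),
        classVal χ.1 c = classVal (Φ' χ).1 (σ' c) := by
  rcases hcase with ⟨Φ, c₀, d₀, σ, h⟩ | ⟨χ₀, ψ₀, hχ₀, hψ₀, Φ, σ, h⟩
  · exact exists_table_equiv_of_agree_off_column Φ c₀ d₀ σ h
  · exact exists_table_equiv_of_agree_off_row hχ₀ hψ₀ Φ σ h
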